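/- The socle Hom_R(𝕜, H^{m+n−2}_I(R)) is an infinite-dimensional 𝕜-vector space. -/

import Mathlib

open CategoryTheory Opposite MvPowerSeries

set_option synthInstance.maxHeartbeats 1000000
set_option maxHeartbeats 1000000

noncomputable section

/-- The grade of an ideal: the maximal length of a regular sequence contained in it. -/
def idealGrade {A : Type} [CommRing A] (J : Ideal A) : ℕ∞ :=
  sSup {c : ℕ∞ | ∃ rs : List A, (∀ r ∈ rs, r ∈ J) ∧
    RingTheory.Sequence.IsRegular A rs ∧ (rs.length : ℕ∞) = c}

/-- The height of an ideal: the infimum of heights of primes containing it. -/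
def idealHeight {A : Type} [CommRing A] (J : Ideal A) : ℕ∞ :=
  sInf {h : ℕ∞ | ∃ p : PrimeSpectrum A, J ≤ p.asIdeal ∧ Order.height p = h}

/-- A canonical module of a `d`-dimensional local ring `A`: a finitely generated module `ω`
with `Ext_A^i(𝕜, ω) = 0` for `i ≠ d` and `Ext_A^d(𝕜, ω)` a one-dimensional `𝕜`-vector space
(equivalently, isomorphic to `𝕜` as an `A`-module), where `𝕜` is the residue field. -/
def IsCanonicalModule (A : Type) [CommRing A] [IsLocalRing A] (d : ℕ)
    (ω : ModuleCat A) : Prop :=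
  Module.Finite A ω ∧
  (∀ i : ℕ, i ≠ d → Subsingleton
    (((Ext A (ModuleCat A) i).obj
      (op (ModuleCat.of A (IsLocalRing.ResidueField A)))).obj ω)) ∧
  Nonempty ((((Ext A (ModuleCat A) d).obj
      (op (ModuleCat.of A (IsLocalRing.ResidueField A)))).obj ω)
    ≃ₗ[A] IsLocalRing.ResidueField A)

variable (𝕜 : Type) [Field 𝕜] (m n : ℕ)

/-- The formal power series ring `P` in the entries of an `m × n` matrix of variables. -/
abbrev DetP := MvPowerSeries (Fin m × Fin n) 𝕜

/-- The ideal of `P` generated by the `2 × 2` minors of the matrix of variables. -/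
def detI2 : Ideal (DetP 𝕜 m n) :=
  Ideal.span {f | ∃ (i k : Fin m) (j l : Fin n), i < k ∧ j < l ∧
    f = X (i, j) * X (k, l) - X (i, l) * X (k, j)}

/-- The complete determinantal ring `R = P/I₂(X)`. -/
abbrev DetR := DetP 𝕜 m n ⧸ detI2 𝕜 m n

/-- The residue class in `R` of the variable `x_{ij}`. -/
def detx (i : Fin m) (j : Fin n) : DetR 𝕜 m n :=
  Ideal.Quotient.mk (detI2 𝕜 m n) (X (i, j))

/-- The ideal `I` of `R` generated by the entries of the first `n - 1` columns. -/
def detJ : Ideal (DetR 𝕜 m n) :=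
  Ideal.span {x | ∃ (i : Fin m) (j : Fin n), (j : ℕ) < n - 1 ∧ x = detx 𝕜 m n i j}

/-- The formal power series ring `S = 𝕜[[x_1, …, x_m, a_1, …, a_{n-1}]]`. -/
abbrev DetS := MvPowerSeries (Fin m ⊕ Fin (n - 1)) 𝕜

/-- The ideal `𝔞 = (a_1, …, a_{n-1})S`. -/
def detA : Ideal (DetS 𝕜 m n) :=
  Ideal.span {f | ∃ j : Fin (n - 1), f = X (Sum.inr j)}

/-- The property pinning down the local `𝕜`-algebra homomorphism `φ : R → S`:
`x_{ij} ↦ a_j·x_i` for `1 ≤ j ≤ n-1` and `x_{in} ↦ x_i` (in `0`-based indexing, the last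
column is `j = n-1`).  Any `𝕜`-algebra homomorphism `R → S` with these values on the
variables automatically maps the maximal ideal into the maximal ideal, hence is continuous
and is uniquely determined by these values; so this predicate characterizes `φ`. -/
def IsDetPhi (φ : DetR 𝕜 m n →ₐ[𝕜] DetS 𝕜 m n) : Prop :=
  ∀ (i : Fin m) (j : Fin n),
    φ (detx 𝕜 m n i j) =
      if h : (j : ℕ) < n - 1 then X (Sum.inr (⟨j, h⟩ : Fin (n - 1))) * X (Sum.inl i)
      else X (Sum.inl i)

namespace TorsionExt

open Abelian

variable {R : Type} [CommRing R] (I : Ideal R)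

/-- The quotient `R / I ^ t` as an object of the category of modules. -/
abbrev quotPow (t : ℕ) : ModuleCat.{0} R := ModuleCat.of R (R ⧸ I ^ t)

/-- The projection `R / I ^ t ⟶ R / I ^ s` for `s ≤ t`. -/
def quotPowMap {s t : ℕ} (h : s ≤ t) : quotPow I t ⟶ quotPow I s :=
  ModuleCat.ofHom (Submodule.mapQ _ _ LinearMap.id (Ideal.pow_le_pow_right h))

lemma quotPowMap_refl (t : ℕ) : quotPowMap I (le_refl t) = 𝟙 _ := by
  ext
  rfl

lemma quotPowMap_comp {s t u : ℕ} (h : s ≤ t) (h' : t ≤ u) :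
    quotPowMap I h' ≫ quotPowMap I h = quotPowMap I (h.trans h') := by
  ext
  rfl

/-- The transition maps of the directed system `Ext^j(R / I ^ t, M)`. -/
def trans (M : ModuleCat.{0} R) (j : ℕ) (s t : ℕ) (h : s ≤ t) :
    Ext (quotPow I s) M j →ₗ[R] Ext (quotPow I t) M j :=
  (Ext.mk₀ (quotPowMap I h)).precompOfLinear R M (zero_add j)

lemma trans_apply (M : ModuleCat.{0} R) (j : ℕ) {s t : ℕ} (h : s ≤ t)
    (x : Ext (quotPow I s) M j) :
    trans I M j s t h x = (Ext.mk₀ (quotPowMap I h)).comp x (zero_add j) := rfl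

instance (M : ModuleCat.{0} R) (j : ℕ) :
    DirectedSystem (fun t : ℕ => Ext (quotPow I t) M j) (fun s t h => trans I M j s t h) where
  map_self t x := by
    simp [trans_apply, quotPowMap_refl]
  map_map a b c h h' x := by
    rw [trans_apply, trans_apply, trans_apply, Ext.mk₀_comp_mk₀_assoc, quotPowMap_comp]

/-- The colimit of `Ext^j(R / I ^ t, M)`. -/
abbrev T (M : ModuleCat.{0} R) (j : ℕ) : Type :=
  Module.DirectLimit (fun t : ℕ => Ext (quotPow I t) M j) (trans I M j)

/-- The canonical map from `Ext^j(R / I ^ t, M)` to the colimit. -/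
abbrev toT (M : ModuleCat.{0} R) (j t : ℕ) : Ext (quotPow I t) M j →ₗ[R] T I M j :=
  Module.DirectLimit.of R ℕ (fun t : ℕ => Ext (quotPow I t) M j) (trans I M j) t

/-- Postcomposition with a class in `Ext^a(M, N)`. -/
def Tcomp {M N : ModuleCat.{0} R} {a j b : ℕ} (β : Ext M N a) (h : j + a = b) :
    T I M j →ₗ[R] T I N b :=
  Module.DirectLimit.map (fun t => β.postcompOfLinear R (quotPow I t) h) (by
    intro s t hst
    ext x
    simp only [LinearMap.comp_apply, trans_apply]
    exact Ext.comp_assoc _ _ _ (zero_add j) h (by omega))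

@[simp]
lemma Tcomp_toT {M N : ModuleCat.{0} R} {a j b : ℕ} (β : Ext M N a) (h : j + a = b) (t : ℕ)
    (x : Ext (quotPow I t) M j) :
    Tcomp I β h (toT I M j t x) = toT I N b t (x.comp β h) := by
  exact Module.DirectLimit.map_apply_of _ _ _

lemma T_induction {M : ModuleCat.{0} R} {j : ℕ} (x : T I M j) :
    ∃ t y, toT I M j t y = x :=
  Module.DirectLimit.exists_of x

lemma toT_eq_zero {M : ModuleCat.{0} R} {j t : ℕ} {x : Ext (quotPow I t) M j} :
    toT I M j t x = 0 ↔ ∃ u, ∃ h : t ≤ u, trans I M j t u h x = 0 := by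
  constructor
  · intro h
    exact Module.DirectLimit.of.zero_exact h
  · rintro ⟨u, h, hx⟩
    rw [toT, ← Module.DirectLimit.of_f (hij := h), hx, map_zero]

lemma toT_trans {M : ModuleCat.{0} R} {j t u : ℕ} (h : t ≤ u) (x : Ext (quotPow I t) M j) :
    toT I M j u (trans I M j t u h x) = toT I M j t x :=
  Module.DirectLimit.of_f

lemma Tcomp_Tcomp {M N K : ModuleCat.{0} R} {a b c j p q : ℕ} (β : Ext M N a) (γ : Ext N K b)
    (h : j + a = p) (h' : p + b = q) (hc : a + b = c) (x : T I M j) :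
    Tcomp I γ h' (Tcomp I β h x) = Tcomp I (β.comp γ hc) (by omega) x := by
  obtain ⟨t, y, rfl⟩ := T_induction I x
  simp only [Tcomp_toT]
  rw [Ext.comp_assoc _ _ _ h hc (by omega)]

lemma Tcomp_zero {M N : ModuleCat.{0} R} {a j b : ℕ} (h : j + a = b) (x : T I M j) :
    Tcomp I (0 : Ext M N a) h x = 0 := by
  obtain ⟨t, y, rfl⟩ := T_induction I x
  simp

/-- Functoriality of the colimit in the module. -/
def Tmap {M N : ModuleCat.{0} R} (f : M ⟶ N) (j : ℕ) : T I M j →ₗ[R] T I N j :=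
  Tcomp I (Ext.mk₀ f) (add_zero j)

lemma Tmap_comp {M N K : ModuleCat.{0} R} (f : M ⟶ N) (g : N ⟶ K) (j : ℕ) (x : T I M j) :
    Tmap I g j (Tmap I f j x) = Tmap I (f ≫ g) j x := by
  rw [Tmap, Tmap, Tcomp_Tcomp I _ _ _ _ (zero_add 0), Ext.mk₀_comp_mk₀]
  rfl

lemma Tmap_id {M : ModuleCat.{0} R} (j : ℕ) (x : T I M j) : Tmap I (𝟙 M) j x = x := by
  obtain ⟨t, y, rfl⟩ := T_induction I x
  simp [Tmap]

section LES

variable {S : ShortComplex (ModuleCat.{0} R)} (hS : S.ShortExact)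

/-- The connecting homomorphism. -/
def Tδ (j : ℕ) : T I S.X₃ j →ₗ[R] T I S.X₁ (j + 1) :=
  Tcomp I hS.extClass rfl

lemma exact_mid (hS : S.ShortExact) (j : ℕ) (x : T I S.X₂ j) (hx : Tmap I S.g j x = 0) :
    ∃ y, Tmap I S.f j y = x := by
  obtain ⟨t, x, rfl⟩ := T_induction I x
  rw [Tmap, Tcomp_toT, toT_eq_zero] at hx
  obtain ⟨u, h, hx⟩ := hx
  rw [trans_apply, ← Ext.comp_assoc _ _ _ (zero_add j) (add_zero j) (by omega)] at hx
  obtain ⟨y, hy⟩ := Ext.covariant_sequence_exact₂ _ hS _ hx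
  refine ⟨toT I _ j u y, ?_⟩
  rw [Tmap, Tcomp_toT, hy, ← trans_apply, toT_trans]

lemma exact_right (j : ℕ) (x : T I S.X₃ j) (hx : Tδ I hS j x = 0) :
    ∃ y, Tmap I S.g j y = x := by
  obtain ⟨t, x, rfl⟩ := T_induction I x
  rw [Tδ, Tcomp_toT, toT_eq_zero] at hx
  obtain ⟨u, h, hx⟩ := hx
  rw [trans_apply, ← Ext.comp_assoc _ _ _ (zero_add j) rfl (by omega)] at hx
  obtain ⟨y, hy⟩ := Ext.covariant_sequence_exact₃ _ hS _ _ hx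
  refine ⟨toT I _ j u y, ?_⟩
  rw [Tmap, Tcomp_toT, hy, ← trans_apply, toT_trans]

lemma exact_left (j : ℕ) (x : T I S.X₁ (j + 1)) (hx : Tmap I S.f (j + 1) x = 0) :
    ∃ y, Tδ I hS j y = x := by
  obtain ⟨t, x, rfl⟩ := T_induction I x
  rw [Tmap, Tcomp_toT, toT_eq_zero] at hx
  obtain ⟨u, h, hx⟩ := hx
  rw [trans_apply, ← Ext.comp_assoc _ _ _ (zero_add _) (add_zero _) (by omega)] at hx
  obtain ⟨y, hy⟩ := Ext.covariant_sequence_exact₁ _ hS _ hx rfl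
  refine ⟨toT I _ j u y, ?_⟩
  rw [Tδ, Tcomp_toT, hy, ← trans_apply, toT_trans]

lemma Tδ_Tmap (j : ℕ) (x : T I S.X₂ j) : Tδ I hS j (Tmap I S.g j x) = 0 := by
  rw [Tδ, Tmap, Tcomp_Tcomp I _ _ _ _ (zero_add 1), hS.comp_extClass, Tcomp_zero]

lemma Tδ_bijective (j : ℕ) (h : Subsingleton (T I S.X₂ j)) (h' : Subsingleton (T I S.X₂ (j + 1))) :
    Function.Bijective (Tδ I hS j) := by
  constructor
  · rw [injective_iff_map_eq_zero]
    intro x hx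
    obtain ⟨y, rfl⟩ := exact_right I hS j x hx
    rw [Subsingleton.elim y 0, map_zero]
  · intro x
    exact exact_left I hS j x (Subsingleton.elim _ _)

lemma Tδ_injective (j : ℕ) (h : Subsingleton (T I S.X₂ j)) :
    Function.Injective (Tδ I hS j) := by
  rw [injective_iff_map_eq_zero]
  intro x hx
  obtain ⟨y, rfl⟩ := exact_right I hS j x hx
  rw [Subsingleton.elim y 0, map_zero]

lemma Tmap_f_bijective (hS : S.ShortExact) (j : ℕ) (h : Subsingleton (T I S.X₃ j))
    (h' : Subsingleton (T I S.X₃ (j + 1))) :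
    Function.Bijective (Tmap I S.f (j + 1)) := by
  constructor
  · rw [injective_iff_map_eq_zero]
    intro x hx
    obtain ⟨y, rfl⟩ := exact_left I hS j x hx
    rw [Subsingleton.elim y 0, map_zero]
  · intro x
    exact exact_mid I hS _ x (Subsingleton.elim _ _)

lemma subsingleton_left (hS : S.ShortExact) (j : ℕ) (h : Subsingleton (T I S.X₃ j))
    (h' : Subsingleton (T I S.X₂ (j + 1))) : Subsingleton (T I S.X₁ (j + 1)) := by
  refine subsingleton_of_forall_eq 0 fun x => ?_
  obtain ⟨y, rfl⟩ := exact_left I hS j x (Subsingleton.elim _ _)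
  rw [Subsingleton.elim y 0, map_zero]

end LES

lemma Tδ_naturality {S₁ S₂ : ShortComplex (ModuleCat.{0} R)} (h₁ : S₁.ShortExact)
    (h₂ : S₂.ShortExact) (f : S₁ ⟶ S₂) (j : ℕ) (x : T I S₁.X₃ j) :
    Tδ I h₂ j (Tmap I f.τ₃ j x) = Tmap I f.τ₁ (j + 1) (Tδ I h₁ j x) := by
  simp only [Tδ, Tmap]
  rw [Tcomp_Tcomp I _ _ _ _ (zero_add 1), Tcomp_Tcomp I _ _ _ _ (add_zero 1)]
  congr 1
  rw [ShortComplex.ShortExact.extClass_naturality h₁ h₂ f]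

/-- If some element of `I` acts bijectively on `M`, then the colimit vanishes. -/
lemma subsingleton_of_bijective (M : ModuleCat.{0} R) (x : R) (hx : x ∈ I)
    (hb : Function.Bijective (fun y : M => x • y)) (j : ℕ) : Subsingleton (T I M j) := by
  refine subsingleton_of_forall_eq 0 fun e => ?_
  obtain ⟨t, e, rfl⟩ := T_induction I e
  have hiso : ∀ k : ℕ, IsIso (x ^ k • 𝟙 M) := by
    intro k
    induction k with
    | zero => simpa using inferInstanceAs (IsIso (𝟙 M))
    | succ k ih =>
      have h1 : IsIso (x • 𝟙 M) := (ConcreteCategory.isIso_iff_bijective _).2 (by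
        exact hb)
      have : x ^ (k + 1) • 𝟙 M = (x ^ k • 𝟙 M) ≫ (x • 𝟙 M) := by
        rw [Linear.smul_comp, Linear.comp_smul, Category.id_comp, smul_smul, pow_succ]
      rw [this]
      infer_instance
  have h0 : x ^ t • e = 0 := by
    have h1 : x ^ t • 𝟙 (quotPow I t) = 0 := by
      refine ModuleCat.hom_ext (LinearMap.ext fun y => ?_)
      obtain ⟨y, rfl⟩ := Ideal.Quotient.mk_surjective y
      change x ^ t • (Ideal.Quotient.mk (I ^ t) y) = 0
      rw [← Ideal.Quotient.mk_eq_mk, ← Submodule.Quotient.mk_smul, Submodule.Quotient.mk_eq_zero]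
      exact Ideal.mul_mem_right _ _ (Ideal.pow_mem_pow hx t)
    rw [← Ext.mk₀_id_comp e, ← Ext.smul_comp, ← Ext.mk₀_smul, h1, Ext.mk₀_zero, Ext.zero_comp]
  have := hiso t
  rw [Ext.smul_eq_comp_mk₀] at h0
  have h2 := congrArg (fun z => z.comp (Ext.mk₀ (inv (x ^ t • 𝟙 M))) (add_zero j)) h0
  simp only [Ext.zero_comp] at h2
  rw [Ext.comp_assoc _ _ _ (add_zero j) (add_zero 0) (by omega), Ext.mk₀_comp_mk₀,
    IsIso.hom_inv_id, Ext.comp_mk₀_id] at h2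
  rw [h2, map_zero]

end TorsionExt

namespace TorsionExt

open Abelian

variable {R : Type} [CommRing R] (I : Ideal R)

/-- Evaluation at `1` on the colimit of `Hom(R / I ^ t, M)`. -/
def ev (M : ModuleCat.{0} R) : T I M 0 →ₗ[R] M :=
  Module.DirectLimit.lift R ℕ _ _ (fun t =>
    { toFun := fun x => (Ext.linearEquiv₀ (R := R) x).hom (Ideal.Quotient.mk (I ^ t) 1)
      map_add' := fun x y => by rw [map_add]; rfl
      map_smul' := fun r x => by rw [map_smul]; rfl }) (by
    intro s t h x
    obtain ⟨f, rfl⟩ := (Ext.linearEquiv₀ (R := R)).symm.surjective x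
    simp only [Ext.linearEquiv₀_symm_apply, trans_apply, Ext.mk₀_comp_mk₀, LinearMap.coe_mk,
      AddHom.coe_mk]
    rw [← Ext.linearEquiv₀_symm_apply (R := R), ← Ext.linearEquiv₀_symm_apply (R := R),
      LinearEquiv.apply_symm_apply, LinearEquiv.apply_symm_apply]
    rfl)

lemma ev_toT (M : ModuleCat.{0} R) (t : ℕ) (f : quotPow I t ⟶ M) :
    ev I M (toT I M 0 t (Ext.mk₀ f)) = f.hom (Ideal.Quotient.mk (I ^ t) 1) := by
  rw [ev, toT, Module.DirectLimit.lift_of, ← Ext.linearEquiv₀_symm_apply (R := R)]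
  simp only [LinearMap.coe_mk, AddHom.coe_mk, LinearEquiv.apply_symm_apply]

lemma exists_rep_zero {M : ModuleCat.{0} R} (x : T I M 0) :
    ∃ t, ∃ f : quotPow I t ⟶ M, toT I M 0 t (Ext.mk₀ f) = x := by
  obtain ⟨t, y, rfl⟩ := T_induction I x
  exact ⟨t, Ext.linearEquiv₀ (R := R) y, by rw [Ext.mk₀_linearEquiv₀_apply]⟩

lemma ev_injective (M : ModuleCat.{0} R) : Function.Injective (ev I M) := by
  rw [injective_iff_map_eq_zero]
  intro x hx
  obtain ⟨t, f, rfl⟩ := exists_rep_zero I x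
  rw [ev_toT] at hx
  have : f = 0 := by
    refine ModuleCat.hom_ext (LinearMap.ext fun y => ?_)
    obtain ⟨y, rfl⟩ := Ideal.Quotient.mk_surjective y
    have h : (Ideal.Quotient.mk (I ^ t) y) = y • (Ideal.Quotient.mk (I ^ t) 1) := by
      rw [← Ideal.Quotient.mk_eq_mk, ← Ideal.Quotient.mk_eq_mk, ← Submodule.Quotient.mk_smul,
        smul_eq_mul, mul_one]
    rw [h]
    exact (f.hom.map_smul y _).trans (by rw [hx, smul_zero]; rfl)
  rw [this, Ext.mk₀_zero, map_zero]

lemma ev_Tmap {M N : ModuleCat.{0} R} (f : M ⟶ N) (x : T I M 0) :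
    ev I N (Tmap I f 0 x) = f.hom (ev I M x) := by
  obtain ⟨t, g, rfl⟩ := exists_rep_zero I x
  rw [Tmap, Tcomp_toT, Ext.mk₀_comp_mk₀, ev_toT, ev_toT]
  rfl

lemma exists_ev_eq {M : ModuleCat.{0} R} (y : M) (t : ℕ) (h : ∀ r ∈ I ^ t, r • y = 0) :
    ∃ x, ev I M x = y := by
  refine ⟨toT I M 0 t (Ext.mk₀ (ModuleCat.ofHom
    (Submodule.liftQ _ (LinearMap.toSpanSingleton R M y) (fun r hr => h r hr)))), ?_⟩
  rw [ev_toT]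
  exact one_smul R y

/-- A module is `I`-power torsion if every element is killed by a power of `I`. -/
def IsPowTorsion (M : Type) [AddCommGroup M] [Module R M] : Prop :=
  ∀ y : M, ∃ t, ∀ r ∈ I ^ t, r • y = 0

/-- On `I`-power torsion modules, evaluation at `1` is bijective. -/
lemma ev_bijective (M : ModuleCat.{0} R) (hM : IsPowTorsion I M) :
    Function.Bijective (ev I M) :=
  ⟨ev_injective I M, fun y => by
    obtain ⟨t, ht⟩ := hM y
    exact exists_ev_eq I y t ht⟩

/-- The `I`-power torsion submodule. -/
def torsPow (M : Type) [AddCommGroup M] [Module R M] : Submodule R M where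
  carrier := {y | ∃ t, ∀ r ∈ I ^ t, r • y = 0}
  zero_mem' := ⟨0, fun r _ => smul_zero r⟩
  add_mem' := by
    rintro x y ⟨s, hs⟩ ⟨t, ht⟩
    refine ⟨max s t, fun r hr => ?_⟩
    rw [smul_add, hs r (Ideal.pow_le_pow_right (le_max_left s t) hr),
      ht r (Ideal.pow_le_pow_right (le_max_right s t) hr), add_zero]
  smul_mem' := by
    rintro a y ⟨t, ht⟩
    exact ⟨t, fun r hr => by rw [smul_comm, ht r hr, smul_zero]⟩

lemma exists_uniform_pow {N M : Type} [AddCommGroup N] [Module R N] [AddCommGroup M] [Module R M]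
    [Module.Finite R N] (g : N →ₗ[R] M) (hg : ∀ x, ∃ t, ∀ r ∈ I ^ t, r • g x = 0) :
    ∃ s, ∀ x, ∀ r ∈ I ^ s, r • g x = 0 := by
  obtain ⟨S, hS⟩ := (Module.Finite.fg_top : (⊤ : Submodule R N).FG)
  choose t ht using hg
  refine ⟨S.sup t, fun x r hr => ?_⟩
  have hx : x ∈ Submodule.span R (S : Set N) := hS ▸ Submodule.mem_top
  induction hx using Submodule.span_induction with
  | mem x hx => exact ht x r (Ideal.pow_le_pow_right (Finset.le_sup hx) hr)
  | zero => simp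
  | add x y _ _ hx hy => rw [map_add, smul_add, hx, hy, add_zero]
  | smul a x _ hx => rw [map_smul, smul_comm, hx, smul_zero]

/-- Over a Noetherian ring, the `I`-power torsion of an injective module is injective. -/
lemma torsPow_baer [IsNoetherianRing R] (E : Type) [AddCommGroup E] [Module R E]
    (hE : Module.Injective R E) : Module.Baer R (torsPow I E) := by
  intro b g
  obtain ⟨s, hs⟩ := exists_uniform_pow I ((torsPow I E).subtype ∘ₗ g) (fun x => (g x).2)
  obtain ⟨k, hk⟩ := Ideal.exists_pow_inf_eq_pow_smul I (M := R) b
  have h1 := hk (k + s) (by omega)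
  have h2 : ∀ x : b, (x : R) ∈ I ^ (k + s) → (torsPow I E).subtype (g x) = 0 := by
    intro x hx
    have hx' : (x : R) ∈ I ^ s • b := by
      have : (x : R) ∈ I ^ (k + s - k) • (I ^ k • (⊤ : Submodule R R) ⊓ b) := by
        rw [← h1]
        exact ⟨by simpa using hx, x.2⟩
      rw [Nat.add_sub_cancel_left] at this
      exact Submodule.smul_mono le_rfl inf_le_right this
    have h3 : ∀ y (hy : y ∈ I ^ s • b), ∃ hy' : y ∈ b,
        (torsPow I E).subtype (g ⟨y, hy'⟩) = 0 := by
      intro y hy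
      induction hy using Submodule.smul_induction_on' with
      | smul r hr z hz =>
        refine ⟨Ideal.mul_mem_left _ _ hz, ?_⟩
        have := hs ⟨z, hz⟩ r hr
        rw [← map_smul] at this
        exact this
      | add x hx y hy hx' hy' =>
        obtain ⟨hx1, hx2⟩ := hx'
        obtain ⟨hy1, hy2⟩ := hy'
        refine ⟨add_mem hx1 hy1, ?_⟩
        have : (⟨x + y, add_mem hx1 hy1⟩ : b) = ⟨x, hx1⟩ + ⟨y, hy1⟩ := rfl
        rw [this, map_add, map_add, hx2, hy2, add_zero]
    exact (h3 x hx').2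
  let p : Submodule R b := Submodule.comap b.subtype (I ^ (k + s))
  let f : (b ⧸ p) →ₗ[R] (R ⧸ I ^ (k + s)) := Submodule.mapQ p (I ^ (k + s)) b.subtype le_rfl
  have hf : Function.Injective f := by
    rw [← LinearMap.ker_eq_bot]
    exact Submodule.ker_mapQ .. |>.trans (by simp [p])
  obtain ⟨h, hh⟩ := hE.out f hf (p.liftQ ((torsPow I E).subtype ∘ₗ g) (fun x hx => h2 x hx))
  refine ⟨LinearMap.codRestrict (torsPow I E) (h ∘ₗ Submodule.mkQ (I ^ (k + s)))
    (fun x => ⟨k + s, fun r hr => ?_⟩), fun x hx => ?_⟩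
  · rw [← map_smul, LinearMap.comp_apply, Submodule.mkQ_apply,
      (Submodule.Quotient.mk_eq_zero _).2
        (by rw [smul_eq_mul]; exact Ideal.mul_mem_right _ _ hr), map_zero]
  · refine Subtype.ext ?_
    exact hh (Submodule.Quotient.mk ⟨x, hx⟩)

/-- An `I`-power torsion module embeds into an injective `I`-power torsion module. -/
lemma exists_injective_powTorsion [IsNoetherianRing R] (M : ModuleCat.{0} R)
    (hM : IsPowTorsion I M) :
    ∃ (E : ModuleCat.{0} R) (f : M ⟶ E), Injective E ∧ IsPowTorsion I E ∧
      Function.Injective f.hom := by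
  obtain ⟨⟨E, hE', ι, hι⟩⟩ := EnoughInjectives.presentation M
  have hE : Module.Injective R E := Module.injective_module_of_injective_object R E
  rw [ModuleCat.mono_iff_injective] at hι
  have h' : Module.Injective R (torsPow I E) := (torsPow_baer I E hE).injective
  refine ⟨ModuleCat.of R (torsPow I E), ModuleCat.ofHom (LinearMap.codRestrict (torsPow I E)
    ι.hom (fun y => ?_)), Module.injective_object_of_injective_module R _,
    fun y => ?_, fun x y hxy => hι (congrArg Subtype.val hxy)⟩
  · obtain ⟨t, ht⟩ := hM y
    exact ⟨t, fun r hr => by rw [← map_smul, ht r hr, map_zero]⟩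
  · obtain ⟨t, ht⟩ := y.2
    exact ⟨t, fun r hr => Subtype.ext (ht r hr)⟩

attribute [local instance] Ext.subsingleton_of_injective in
lemma subsingleton_of_injective (M : ModuleCat.{0} R) [Injective M] (j : ℕ) :
    Subsingleton (T I M (j + 1)) := by
  refine subsingleton_of_forall_eq 0 fun e => ?_
  obtain ⟨t, e, rfl⟩ := T_induction I e
  rw [Subsingleton.elim e 0, map_zero]

/-- The short complex `M ⟶ N ⟶ N / M` attached to a linear map. -/
lemma shortExact_of_injective {M N : ModuleCat.{0} R} (f : M ⟶ N)
    (hf : Function.Injective f.hom) :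
    (ShortComplex.mk f (ModuleCat.ofHom (LinearMap.range f.hom).mkQ)
      (ModuleCat.hom_ext (LinearMap.range_mkQ_comp f.hom))).ShortExact := by
  refine { exact := ?_, mono_f := (ModuleCat.mono_iff_injective _).2 hf
           epi_g := (ModuleCat.epi_iff_surjective _).2 (Submodule.mkQ_surjective _) }
  rw [ShortComplex.moduleCat_exact_iff]
  intro x hx
  exact (Submodule.Quotient.mk_eq_zero _).1 hx

/-- `I`-power torsion modules are acyclic. -/
lemma subsingleton_of_isPowTorsion [IsNoetherianRing R] (M : ModuleCat.{0} R)
    (hM : IsPowTorsion I M) (j : ℕ) : Subsingleton (T I M (j + 1)) := by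
  induction j generalizing M with
  | zero =>
    obtain ⟨E, f, hE, hE', hf⟩ := exists_injective_powTorsion I M hM
    have hS := shortExact_of_injective f hf
    refine subsingleton_of_forall_eq 0 fun e => ?_
    have := subsingleton_of_injective I E 0
    obtain ⟨y, rfl⟩ := exact_left I hS 0 e (Subsingleton.elim (α := T I E 1) _ _)
    obtain ⟨z, hz⟩ := Submodule.mkQ_surjective _ (ev I _ y)
    obtain ⟨w, hw⟩ := (ev_bijective I E hE').2 z
    have : y = Tmap I (ModuleCat.ofHom (LinearMap.range f.hom).mkQ) 0 w := by
      apply ev_injective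
      rw [ev_Tmap, hw]
      exact hz.symm
    rw [this]
    exact Tδ_Tmap I hS 0 w
  | succ j ih =>
    obtain ⟨E, f, hE, hE', hf⟩ := exists_injective_powTorsion I M hM
    have hS := shortExact_of_injective f hf
    refine subsingleton_left I hS (j + 1) (ih _ fun y => ?_) (subsingleton_of_injective I E _)
    obtain ⟨y, rfl⟩ := Submodule.mkQ_surjective _ y
    obtain ⟨t, ht⟩ := hE' y
    exact ⟨t, fun r hr => by rw [← map_smul, ht r hr, map_zero]⟩

end TorsionExt

namespace TorsionExt

variable {R : Type} [CommRing R]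

section Comparison

variable {X X' Y : ModuleCat.{0} R}

/-- The complex computing the derived functor version of `Ext`. -/
abbrev homComplex (P : ProjectiveResolution X) (Y : ModuleCat.{0} R) :
    ChainComplex (ModuleCat.{0} R)ᵒᵖ ℕ :=
  (((linearYoneda R (ModuleCat.{0} R)).obj Y).rightOp.mapHomologicalComplex _).obj P.complex

/-- The derived functor version of `Ext`. -/
abbrev OldExt (X Y : ModuleCat.{0} R) (n : ℕ) : ModuleCat.{0} R :=
  ((Ext R (ModuleCat.{0} R) n).obj (op X)).obj Y

/-- The cocycle underlying a class of cocycles. -/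
def cocycleVal (P : ProjectiveResolution X) (Y : ModuleCat.{0} R) (n : ℕ) :
    ((homComplex P Y).opcycles n).unop →ₗ[R] (P.complex.X n ⟶ Y) :=
  ((homComplex P Y).pOpcycles n).unop.hom

/-- The class of a cocycle. -/
def cocycleClass (P : ProjectiveResolution X) (Y : ModuleCat.{0} R) (n : ℕ) :
    ((homComplex P Y).opcycles n).unop →ₗ[R] OldExt X Y n :=
  (P.isoLeftDerivedObj ((linearYoneda R (ModuleCat.{0} R)).obj Y).rightOp n).hom.unop.hom ∘ₗ
    ((homComplex P Y).homologyι n).unop.hom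

lemma cocycleVal_injective (P : ProjectiveResolution X) (Y : ModuleCat.{0} R) (n : ℕ) :
    Function.Injective (cocycleVal P Y n) :=
  (ModuleCat.mono_iff_injective ((homComplex P Y).pOpcycles n).unop).1 inferInstance

lemma exists_cocycleVal_eq (P : ProjectiveResolution X) (Y : ModuleCat.{0} R) (n : ℕ)
    (f : P.complex.X n ⟶ Y) (hf : P.complex.d (n + 1) n ≫ f = 0) :
    ∃ c, cocycleVal P Y n c = f := by
  let g : ModuleCat.of R R ⟶ ((homComplex P Y).X n).unop :=
    ModuleCat.ofHom (LinearMap.toSpanSingleton R (P.complex.X n ⟶ Y) f)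
  have hg : (homComplex P Y).d (n + 1) n ≫ g.op = 0 := by
    apply Quiver.Hom.unop_inj
    refine ModuleCat.hom_ext (LinearMap.ext_ring ?_)
    change P.complex.d (n + 1) n ≫ ((1 : R) • f) = 0
    rw [one_smul, hf]
  let k := (homComplex P Y).descOpcycles g.op (n + 1) (by simp) hg
  refine ⟨k.unop.hom (1 : R), ?_⟩
  have h := (homComplex P Y).p_descOpcycles g.op (n + 1) (by simp) hg
  have h' := congrArg (fun z => z.unop.hom (1 : R)) h
  exact h'.trans (one_smul R f)

lemma cocycleClass_eq_zero_iff (P : ProjectiveResolution X) (Y : ModuleCat.{0} R) (n : ℕ)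
    (c : ((homComplex P Y).opcycles (n + 1)).unop) :
    cocycleClass P Y (n + 1) c = 0 ↔
      ∃ g : P.complex.X n ⟶ Y, P.complex.d (n + 1) n ≫ g = cocycleVal P Y (n + 1) c := by
  have h1 : cocycleClass P Y (n + 1) c = 0 ↔
      ((homComplex P Y).homologyι (n + 1)).unop.hom c = 0 := by
    have : Function.Injective (P.isoLeftDerivedObj
        ((linearYoneda R (ModuleCat.{0} R)).obj Y).rightOp (n + 1)).hom.unop.hom :=
      (ModuleCat.mono_iff_injective (P.isoLeftDerivedObj
        ((linearYoneda R (ModuleCat.{0} R)).obj Y).rightOp (n + 1)).hom.unop).1 inferInstance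
    exact map_eq_zero_iff _ this
  rw [h1]
  have hex := (ShortComplex.exact_of_f_is_kernel (ShortComplex.mk _ _
    ((homComplex P Y).homologyι_comp_fromOpcycles (n + 1) n))
    ((homComplex P Y).homologyIsKernel (n + 1) n (by simp))).unop
  rw [ShortComplex.moduleCat_exact_iff] at hex
  have hval : ∀ g : P.complex.X n ⟶ Y, cocycleVal P Y (n + 1)
      (((homComplex P Y).fromOpcycles (n + 1) n).unop.hom g) = P.complex.d (n + 1) n ≫ g := by
    intro g
    have h := (homComplex P Y).p_fromOpcycles (n + 1) n
    exact congrArg (fun z => z.unop.hom g) h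
  constructor
  · intro h
    obtain ⟨g, hg⟩ := hex c h
    exact ⟨g, (hval g).symm.trans (congrArg _ hg)⟩
  · rintro ⟨g, hg⟩
    rw [← hval] at hg
    rw [← cocycleVal_injective P Y _ hg]
    have h := (homComplex P Y).homologyι_comp_fromOpcycles (n + 1) n
    exact congrArg (fun z => z.unop.hom g) h

lemma cocycleClass_naturality {P' : ProjectiveResolution X'} {P : ProjectiveResolution X}
    {g : X' ⟶ X} (φ : ProjectiveResolution.Hom P' P g) (Y : ModuleCat.{0} R) (n : ℕ)
    (c : ((homComplex P Y).opcycles n).unop) :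
    ∃ c', cocycleVal P' Y n c' = φ.hom.f n ≫ cocycleVal P Y n c ∧
      cocycleClass P' Y n c' =
        (((Ext R (ModuleCat.{0} R) n).map g.op).app Y).hom (cocycleClass P Y n c) := by
  let F := ((linearYoneda R (ModuleCat.{0} R)).obj Y).rightOp
  let φ' : homComplex P' Y ⟶ homComplex P Y := (F.mapHomologicalComplex _).map φ.hom
  refine ⟨(HomologicalComplex.opcyclesMap φ' n).unop.hom c, ?_, ?_⟩
  · have h := HomologicalComplex.p_opcyclesMap φ' n
    exact congrArg (fun z => z.unop.hom c) h
  · have h1 := HomologicalComplex.homologyι_naturality φ' n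
    have h2 := ProjectiveResolution.isoLeftDerivedObj_hom_naturality g P' P φ.hom
      (by simpa using φ.hom_f_zero_comp_π_f_zero) F n
    have h3 := congrArg (fun z => z.unop.hom c) h1
    have h4 := congrArg (fun z => z.unop.hom (((homComplex P Y).homologyι n).unop.hom c)) h2
    refine Eq.trans ?_ h4.symm
    exact congrArg (P'.isoLeftDerivedObj F n).hom.unop.hom h3.symm

/-- An element of the derived functor version of `Ext` corresponds to an element of the derived
category version if both are represented by the same cocycle. -/
def Corresponds (n : ℕ) (e : Abelian.Ext X Y (n + 1)) (o : OldExt X Y (n + 1)) : Prop :=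
  ∃ (c : ((homComplex (projectiveResolution X) Y).opcycles (n + 1)).unop)
    (h : (projectiveResolution X).complex.d (n + 1 + 1) (n + 1) ≫
      cocycleVal (projectiveResolution X) Y (n + 1) c = 0),
    cocycleClass (projectiveResolution X) Y (n + 1) c = o ∧
    (projectiveResolution X).extMk (cocycleVal (projectiveResolution X) Y (n + 1) c) _ rfl h = e

lemma Corresponds.exists (n : ℕ) (e : Abelian.Ext X Y (n + 1)) : ∃ o, Corresponds n e o := by
  obtain ⟨f, hf, rfl⟩ := (projectiveResolution X).extMk_surjective e _ rfl
  obtain ⟨c, rfl⟩ := exists_cocycleVal_eq (projectiveResolution X) Y (n + 1) f hf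
  exact ⟨_, c, hf, rfl, rfl⟩

lemma Corresponds.add {n : ℕ} {e e' : Abelian.Ext X Y (n + 1)} {o o' : OldExt X Y (n + 1)}
    (h : Corresponds n e o) (h' : Corresponds n e' o') : Corresponds n (e + e') (o + o') := by
  obtain ⟨c, hc, rfl, rfl⟩ := h
  obtain ⟨c', hc', rfl, rfl⟩ := h'
  refine ⟨c + c', ?_, map_add _ _ _, ?_⟩
  · rw [map_add, Preadditive.comp_add, hc, hc', add_zero]
  · rw [ProjectiveResolution.add_extMk]
    congr 1
    exact map_add _ _ _

lemma Corresponds.smul {n : ℕ} {e : Abelian.Ext X Y (n + 1)} {o : OldExt X Y (n + 1)} (r : R)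
    (h : Corresponds n e o) : Corresponds n (r • e) (r • o) := by
  obtain ⟨c, hc, rfl, rfl⟩ := h
  refine ⟨r • c, ?_, map_smul _ _ _, ?_⟩
  · rw [map_smul, Linear.comp_smul, hc, smul_zero]
  · rw [Abelian.Ext.smul_eq_comp_mk₀, ProjectiveResolution.extMk_comp_mk₀]
    congr 1
    rw [map_smul, Linear.comp_smul, Category.comp_id]

lemma Corresponds.eq_zero_iff {n : ℕ} {e : Abelian.Ext X Y (n + 1)} {o : OldExt X Y (n + 1)}
    (h : Corresponds n e o) : e = 0 ↔ o = 0 := by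
  obtain ⟨c, hc, rfl, rfl⟩ := h
  rw [ProjectiveResolution.extMk_eq_zero_iff _ _ _ _ _ n rfl, cocycleClass_eq_zero_iff]

lemma Corresponds.unique {n : ℕ} {e : Abelian.Ext X Y (n + 1)} {o o' : OldExt X Y (n + 1)}
    (h : Corresponds n e o) (h' : Corresponds n e o') : o = o' := by
  have := (h.add (h'.smul (-1 : R))).eq_zero_iff
  rw [neg_one_smul, neg_one_smul, add_neg_cancel] at this
  exact add_neg_eq_zero.1 (this.1 rfl)

lemma Corresponds.naturality {n : ℕ} {e : Abelian.Ext X Y (n + 1)} {o : OldExt X Y (n + 1)}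
    (h : Corresponds n e o) (g : X' ⟶ X) :
    Corresponds n ((Abelian.Ext.mk₀ g).comp e (zero_add _))
      ((((Ext R (ModuleCat.{0} R) (n + 1)).map g.op).app Y).hom o) := by
  obtain ⟨c, hc, rfl, rfl⟩ := h
  let φ : ProjectiveResolution.Hom (projectiveResolution X') (projectiveResolution X) g :=
    { hom := ProjectiveResolution.lift g _ _
      hom_f_zero_comp_π_f_zero := by
        simpa using ProjectiveResolution.lift_commutes_zero g _ _ }
  obtain ⟨c', hc', h'⟩ := cocycleClass_naturality φ Y (n + 1) c
  refine ⟨c', ?_, h', ?_⟩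
  · rw [hc', ← φ.hom.comm_assoc, hc, Limits.comp_zero]
  · rw [ProjectiveResolution.mk₀_comp_extMk _ _ _ _ φ]
    congr 1

/-- The comparison map between the two versions of `Ext`. -/
def extComparison (X Y : ModuleCat.{0} R) (n : ℕ) :
    Abelian.Ext X Y (n + 1) →ₗ[R] OldExt X Y (n + 1) where
  toFun e := (Corresponds.exists n e).choose
  map_add' e e' := (Corresponds.exists n (e + e')).choose_spec.unique
    ((Corresponds.exists n e).choose_spec.add (Corresponds.exists n e').choose_spec)
  map_smul' r e := (Corresponds.exists n (r • e)).choose_spec.unique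
    ((Corresponds.exists n e).choose_spec.smul r)

lemma corresponds_extComparison (n : ℕ) (e : Abelian.Ext X Y (n + 1)) :
    Corresponds n e (extComparison X Y n e) :=
  (Corresponds.exists n e).choose_spec

lemma extComparison_injective (n : ℕ) : Function.Injective (extComparison X Y n) := by
  rw [injective_iff_map_eq_zero]
  intro e he
  exact (corresponds_extComparison n e).eq_zero_iff.2 he

lemma extComparison_naturality (n : ℕ) (e : Abelian.Ext X Y (n + 1)) (g : X' ⟶ X) :
    extComparison X' Y n ((Abelian.Ext.mk₀ g).comp e (zero_add _)) =
      (((Ext R (ModuleCat.{0} R) (n + 1)).map g.op).app Y).hom (extComparison X Y n e) :=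
  (corresponds_extComparison n _).unique ((corresponds_extComparison n e).naturality g)

end Comparison

/-- The canonical map from a term of the directed system to local cohomology. -/
def toLocalCohomology (J : Ideal R) (n : ℕ) (M : ModuleCat.{0} R) (t : ℕ) :
    OldExt (quotPow J t) M n ⟶ (localCohomology J n).obj M :=
  (Limits.colimit.ι (localCohomology.diagram (localCohomology.idealPowersDiagram J) n)
    (op (op t))).app M

lemma toLocalCohomology_map (J : Ideal R) (n : ℕ) (M : ModuleCat.{0} R) {s t : ℕ} (h : s ≤ t) :
    ((Ext R (ModuleCat.{0} R) n).map (quotPowMap J h).op).app M ≫ toLocalCohomology J n M t =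
      toLocalCohomology J n M s := by
  have := Limits.colimit.w (localCohomology.diagram (localCohomology.idealPowersDiagram J) n)
    (homOfLE h).op.op
  exact congrArg (fun z => z.app M) this

lemma toLocalCohomology_eq_zero (J : Ideal R) (n : ℕ) (M : ModuleCat.{0} R) (t : ℕ)
    (o : OldExt (quotPow J t) M n) (ho : (toLocalCohomology J n M t).hom o = 0) :
    ∃ u, ∃ h : t ≤ u,
      (((Ext R (ModuleCat.{0} R) n).map (quotPowMap J h).op).app M).hom o = 0 := by
  let D := localCohomology.diagram (localCohomology.idealPowersDiagram J) n
  let ev := (evaluation (ModuleCat.{0} R) (ModuleCat.{0} R)).obj M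
  have hc : Limits.IsColimit (ev.mapCocone (Limits.colimit.cocone D)) :=
    Limits.isColimitOfPreserves ev (Limits.colimit.isColimit D)
  have h0 : (ev.mapCocone (Limits.colimit.cocone D)).ι.app (op (op t)) o =
      (ev.mapCocone (Limits.colimit.cocone D)).ι.app (op (op t))
        (0 : OldExt (quotPow J t) M n) := by
    refine Eq.trans ho (Eq.symm ?_)
    exact map_zero (toLocalCohomology J n M t).hom
  obtain ⟨k, f, g, hfg⟩ := (Limits.Concrete.isColimit_rep_eq_iff_exists (D ⋙ ev)
    (i := op (op t)) (j := op (op t)) hc o (0 : OldExt (quotPow J t) M n)).1 h0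
  refine ⟨k.unop.unop, leOfHom f.unop.unop, ?_⟩
  refine Eq.trans hfg ?_
  exact map_zero ((D ⋙ ev).map g).hom

/-- The comparison map from the colimit of the derived category version of `Ext` to local
cohomology. -/
def localCohomologyComparison (J : Ideal R) (n : ℕ) (M : ModuleCat.{0} R) :
    T J M (n + 1) →ₗ[R] (localCohomology J (n + 1)).obj M :=
  Module.DirectLimit.lift R ℕ _ _
    (fun t => (toLocalCohomology J (n + 1) M t).hom ∘ₗ extComparison (quotPow J t) M n) (by
    intro s t h x
    have h1 := extComparison_naturality n x (quotPowMap J h)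
    have h2 := congrArg (fun z => z.hom (extComparison (quotPow J s) M n x))
      (toLocalCohomology_map J (n + 1) M h)
    simp only [LinearMap.comp_apply, trans_apply]
    rw [h1]
    exact h2)

lemma localCohomologyComparison_injective (J : Ideal R) (n : ℕ) (M : ModuleCat.{0} R) :
    Function.Injective (localCohomologyComparison J n M) := by
  rw [injective_iff_map_eq_zero]
  intro x hx
  obtain ⟨t, x, rfl⟩ := T_induction J x
  rw [localCohomologyComparison, toT, Module.DirectLimit.lift_of] at hx
  obtain ⟨u, h, hu⟩ := toLocalCohomology_eq_zero J (n + 1) M t _ hx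
  rw [toT_eq_zero]
  refine ⟨u, h, extComparison_injective n ?_⟩
  rw [map_zero, trans_apply, extComparison_naturality, hu]

end TorsionExt

namespace Segre

/-- In a ring where the `2 × 2` minors of `x` vanish, a monomial only depends on its row and column
multiplicities. -/
lemma prod_eq_of_map_eq {α β A : Type*} [CommRing A] (x : α × β → A)
    (hx : ∀ i k j l, x (i, j) * x (k, l) = x (i, l) * x (k, j)) (s t : Multiset (α × β))
    (h₁ : s.map Prod.fst = t.map Prod.fst) (h₂ : s.map Prod.snd = t.map Prod.snd) :
    (s.map x).prod = (t.map x).prod := by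
  classical
  induction t using Multiset.induction_on generalizing s with
  | empty =>
    have : s = 0 := by simpa using h₁
    simp [this]
  | cons c t ih =>
    obtain ⟨i, j⟩ := c
    by_cases hc : (i, j) ∈ s
    · obtain ⟨s, rfl⟩ := Multiset.exists_cons_of_mem hc
      simp only [Multiset.map_cons, Multiset.cons_inj_right, Multiset.prod_cons] at h₁ h₂ ⊢
      rw [ih s h₁ h₂]
    · have hi : i ∈ s.map Prod.fst := by rw [h₁]; simp
      have hj : j ∈ s.map Prod.snd := by rw [h₂]; simp
      obtain ⟨⟨i', l⟩, hil, rfl⟩ := Multiset.mem_map.1 hi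
      obtain ⟨⟨k, j'⟩, hkj, rfl⟩ := Multiset.mem_map.1 hj
      simp only at hc h₁ h₂ ⊢
      obtain ⟨s, rfl⟩ := Multiset.exists_cons_of_mem hil
      have hne : (k, j') ≠ (i', l) := by
        rintro h
        simp only [Prod.mk.injEq] at h
        obtain ⟨rfl, rfl⟩ := h
        exact hc hkj
      have hkj' : (k, j') ∈ s := by
        simpa [hne] using hkj
      obtain ⟨s, rfl⟩ := Multiset.exists_cons_of_mem hkj'
      have := ih ((k, l) ::ₘ s)
        (by simpa using h₁)
        (by
          simp only [Multiset.map_cons] at h₂ ⊢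
          rw [Multiset.cons_swap] at h₂
          simpa using h₂)
      simp only [Multiset.map_cons, Multiset.prod_cons] at this ⊢
      rw [← this, ← mul_assoc, ← mul_assoc, hx i' k l j']

variable {𝕜}

/-- A power series without terms of degree less than `N` lies in the `N`-th power of the ideal
generated by the variables. -/
lemma mem_pow_of_coeff_eq_zero {σ : Type} [Fintype σ] (N : ℕ) (f : MvPowerSeries σ 𝕜)
    (hf : ∀ d : σ →₀ ℕ, d.degree < N → coeff d f = 0) :
    f ∈ Ideal.span (Set.range (X : σ → MvPowerSeries σ 𝕜)) ^ N := by
  classical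
  induction N generalizing f with
  | zero => simp
  | succ N ih =>
    have hne : ∀ d : σ →₀ ℕ, ∃ s : Option σ, (s = none → d = 0) ∧ ∀ i, s = some i → d i ≠ 0 := by
      intro d
      by_cases hd : d = 0
      · exact ⟨none, fun _ => hd, by simp⟩
      · obtain ⟨i, hi⟩ := Finsupp.ne_iff.1 hd
        exact ⟨some i, by simp, by rintro j ⟨⟩; simpa using hi⟩
    choose c hc₁ hc₂ using hne
    let g : σ → MvPowerSeries σ 𝕜 := fun i d =>
      if c (d + Finsupp.single i 1) = some i then coeff (d + Finsupp.single i 1) f else 0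
    have hg : ∀ i d, coeff d (g i) =
      if c (d + Finsupp.single i 1) = some i then coeff (d + Finsupp.single i 1) f else 0 :=
      fun i d => rfl
    have key : f = ∑ i, g i * X i := by
      ext d
      have hterm : ∀ i, coeff d (g i * X i) = if c d = some i then coeff d f else 0 := by
        intro i
        rw [X, coeff_mul_monomial]
        split_ifs with h1 h2 h2
        · rw [hg, tsub_add_cancel_of_le h1, if_pos h2, mul_one]
        · rw [hg, tsub_add_cancel_of_le h1, if_neg h2, zero_mul]
        · exact absurd (Finsupp.single_le_iff.2 (Nat.one_le_iff_ne_zero.2 (hc₂ d i h2))) h1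
        · rfl
      rw [map_sum, Finset.sum_congr rfl fun i _ => hterm i]
      rcases h : c d with _ | i
      · simp only [reduceCtorEq, if_false, Finset.sum_const_zero]
        rw [hc₁ d h]
        exact hf 0 (by simp)
      · simp
    rw [key]
    refine Ideal.sum_mem _ fun i _ => ?_
    rw [pow_succ]
    refine Ideal.mul_mem_mul (ih _ fun d hd => ?_) (Ideal.subset_span ⟨i, rfl⟩)
    rw [hg]
    split_ifs
    · exact hf _ (by simp [map_add, hd])
    · rfl

variable {m n}

/-- The exponent of the monomial `u_i v_j`. -/
def unitWeight (c : Fin m × Fin n) : (Fin m ⊕ Fin n) →₀ ℕ :=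
  Finsupp.single (Sum.inl c.1) 1 + Finsupp.single (Sum.inr c.2) 1

variable (𝕜) in
lemma hasSubst_unitWeight :
    HasSubst fun c : Fin m × Fin n => monomial (unitWeight c) (1 : 𝕜) := by
  refine hasSubst_of_constantCoeff_zero fun c => ?_
  classical
  rw [← coeff_zero_eq_constantCoeff_apply, coeff_monomial, if_neg]
  intro h
  have := DFunLike.congr_fun h (Sum.inl c.1)
  simp [unitWeight] at this

variable (𝕜 m n) in
/-- The homomorphism `x_{ij} ↦ u_i v_j`. -/
def segre : DetP 𝕜 m n →ₐ[𝕜] MvPowerSeries (Fin m ⊕ Fin n) 𝕜 :=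
  substAlgHom (hasSubst_unitWeight 𝕜)

/-- The exponent of the image of a monomial. -/
def weight (d : (Fin m × Fin n) →₀ ℕ) : (Fin m ⊕ Fin n) →₀ ℕ :=
  d.sum fun c k => k • unitWeight c

lemma weight_add (d e : (Fin m × Fin n) →₀ ℕ) : weight (d + e) = weight d + weight e :=
  Finsupp.sum_add_index' (by simp) (by intros; rw [add_smul])

lemma weight_single (c : Fin m × Fin n) (k : ℕ) :
    weight (Finsupp.single c k) = k • unitWeight c :=
  Finsupp.sum_single_index (by simp)

lemma weight_zero : weight (0 : (Fin m × Fin n) →₀ ℕ) = 0 := Finsupp.sum_zero_index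

lemma weight_inl (d : (Fin m × Fin n) →₀ ℕ) (i : Fin m) :
    weight d (Sum.inl i) = (d.toMultiset.map Prod.fst).count i := by
  classical
  induction d using Finsupp.induction_linear with
  | zero => simp [weight_zero]
  | add d e h h' => simp [weight_add, h, h']
  | single c k =>
    simp [weight_single, unitWeight, Multiset.map_nsmul, Multiset.count_singleton,
      Finsupp.single_apply, eq_comm]

lemma weight_inr (d : (Fin m × Fin n) →₀ ℕ) (j : Fin n) :
    weight d (Sum.inr j) = (d.toMultiset.map Prod.snd).count j := by
  classical
  induction d using Finsupp.induction_linear with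
  | zero => simp [weight_zero]
  | add d e h h' => simp [weight_add, h, h']
  | single c k =>
    simp [weight_single, unitWeight, Multiset.map_nsmul, Multiset.count_singleton,
      Finsupp.single_apply, eq_comm]

lemma sum_weight_inl (d : (Fin m × Fin n) →₀ ℕ) : ∑ i, weight d (Sum.inl i) = d.degree := by
  classical
  induction d using Finsupp.induction_linear with
  | zero => simp [weight_zero]
  | add d e h h' => simp [weight_add, h, h', Finset.sum_add_distrib]
  | single c k => simp [weight_single, unitWeight, Finsupp.single_apply]

lemma sum_weight_inr (d : (Fin m × Fin n) →₀ ℕ) : ∑ j, weight d (Sum.inr j) = d.degree := by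
  classical
  induction d using Finsupp.induction_linear with
  | zero => simp [weight_zero]
  | add d e h h' => simp [weight_add, h, h', Finset.sum_add_distrib]
  | single c k => simp [weight_single, unitWeight, Finsupp.single_apply]

lemma degree_eq_of_weight_eq {d e : (Fin m × Fin n) →₀ ℕ} (h : weight d = weight e) :
    d.degree = e.degree := by
  rw [← sum_weight_inl, ← sum_weight_inl, h]

/-- Every balanced exponent is the weight of a monomial. -/
lemma exists_weight_eq (e : (Fin m ⊕ Fin n) →₀ ℕ)
    (he : ∑ i, e (Sum.inl i) = ∑ j, e (Sum.inr j)) : ∃ d : (Fin m × Fin n) →₀ ℕ, weight d = e := by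
  classical
  induction hN : ∑ i, e (Sum.inl i) generalizing e with
  | zero =>
    refine ⟨0, ?_⟩
    rw [weight_zero]
    rw [hN] at he
    have h₁ := Finset.sum_eq_zero_iff.1 hN
    have h₂ := Finset.sum_eq_zero_iff.1 he.symm
    ext (i | j)
    · exact (h₁ i (Finset.mem_univ i)).symm
    · exact (h₂ j (Finset.mem_univ j)).symm
  | succ N ih =>
    obtain ⟨i, -, hi⟩ := Finset.exists_ne_zero_of_sum_ne_zero (by rw [hN]; exact Nat.succ_ne_zero N)
    obtain ⟨j, -, hj⟩ := Finset.exists_ne_zero_of_sum_ne_zero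
      (by rw [← he, hN]; exact Nat.succ_ne_zero N)
    have hle : unitWeight (i, j) ≤ e := by
      rintro (k | k)
      · by_cases h : i = k
        · subst h; simpa [unitWeight] using Nat.one_le_iff_ne_zero.2 (by assumption)
        · simp [unitWeight, h]
      · by_cases h : j = k
        · subst h; simpa [unitWeight] using Nat.one_le_iff_ne_zero.2 (by assumption)
        · simp [unitWeight, h]
    obtain ⟨e, rfl⟩ := exists_add_of_le hle
    have h₁ : ∑ k, unitWeight (i, j) (Sum.inl k) = 1 := by simp [unitWeight, Finsupp.single_apply]
    have h₂ : ∑ k, unitWeight (i, j) (Sum.inr k) = 1 := by simp [unitWeight, Finsupp.single_apply]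
    simp only [Finsupp.add_apply, Finset.sum_add_distrib, h₁, h₂] at he hN
    obtain ⟨d, hd⟩ := ih e (by omega) (by omega)
    exact ⟨Finsupp.single (i, j) 1 + d, by rw [weight_add, weight_single, hd, one_smul]⟩

lemma segre_X (c : Fin m × Fin n) : segre 𝕜 m n (X c) = monomial (unitWeight c) 1 :=
  substAlgHom_X _ c

lemma prod_unitWeight (d : (Fin m × Fin n) →₀ ℕ) :
    (d.prod fun c k => monomial (unitWeight c) (1 : 𝕜) ^ k) = monomial (weight d) 1 := by
  induction d using Finsupp.induction_linear with
  | zero => rw [weight_zero]; rfl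
  | add d e h h' =>
    rw [Finsupp.prod_add_index' (by simp) (by intros; rw [pow_add]), h, h', weight_add,
      monomial_mul_monomial, one_mul]
  | single c k =>
    rw [Finsupp.prod_single_index (by simp), weight_single, monomial_pow, one_pow]

lemma finite_weight_eq (e : (Fin m ⊕ Fin n) →₀ ℕ) :
    {d : (Fin m × Fin n) →₀ ℕ | weight d = e}.Finite := by
  classical
  refine Set.Finite.subset (Finsupp.finite_of_degree_le (∑ i, e (Sum.inl i))) ?_
  rintro d rfl
  exact (sum_weight_inl d).ge

lemma coeff_segre (p : DetP 𝕜 m n) (e : (Fin m ⊕ Fin n) →₀ ℕ) :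
    coeff e (segre 𝕜 m n p) = ∑ d ∈ (finite_weight_eq e).toFinset, coeff d p := by
  classical
  rw [segre, coe_substAlgHom, coeff_subst (hasSubst_unitWeight 𝕜)]
  rw [finsum_eq_sum_of_support_subset (s := (finite_weight_eq e).toFinset)]
  · refine Finset.sum_congr rfl fun d hd => ?_
    have : weight d = e := by simpa using hd
    rw [prod_unitWeight, coeff_monomial, if_pos this.symm, smul_eq_mul, mul_one]
  · intro d hd
    rw [Function.mem_support, prod_unitWeight, coeff_monomial] at hd
    simp only [Set.Finite.coe_toFinset, Set.mem_ofPred_eq]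
    by_contra h
    exact hd (by rw [if_neg (Ne.symm h), smul_zero])

end Segre

namespace Segre
variable {𝕜} {m n}

lemma constantCoeff_segre (p : DetP 𝕜 m n) :
    constantCoeff (segre 𝕜 m n p) = constantCoeff p := by
  rw [← coeff_zero_eq_constantCoeff_apply, ← coeff_zero_eq_constantCoeff_apply, coeff_segre]
  rw [Finset.sum_eq_single_of_mem 0 (by simp [weight_zero])]
  intro d hd hd'
  have : weight d = 0 := by simpa using hd
  have h : d.degree = 0 := by
    rw [degree_eq_of_weight_eq (this.trans weight_zero.symm), map_zero]
  exact absurd ((Finsupp.degree_eq_zero_iff d).1 h) hd'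

lemma detI2_le_ker : detI2 𝕜 m n ≤ RingHom.ker (segre 𝕜 m n) := by
  rw [detI2, Ideal.span_le]
  rintro _ ⟨i, k, j, l, -, -, rfl⟩
  simp only [SetLike.mem_coe, RingHom.mem_ker, map_sub, map_mul, segre_X, monomial_mul_monomial,
    unitWeight]
  rw [sub_eq_zero]
  congr 2
  abel

lemma detx_mul_detx (i k : Fin m) (j l : Fin n) :
    detx 𝕜 m n i j * detx 𝕜 m n k l = detx 𝕜 m n i l * detx 𝕜 m n k j := by
  have key : ∀ (i k : Fin m) (j l : Fin n), i < k → j < l →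
      detx 𝕜 m n i j * detx 𝕜 m n k l = detx 𝕜 m n i l * detx 𝕜 m n k j := by
    intro i k j l hik hjl
    simp only [detx, ← map_mul]
    rw [Ideal.Quotient.eq]
    exact Ideal.subset_span ⟨i, k, j, l, hik, hjl, rfl⟩
  rcases lt_trichotomy i k with hik | rfl | hik
  · rcases lt_trichotomy j l with hjl | rfl | hjl
    · exact key i k j l hik hjl
    · rfl
    · exact (key i k l j hik hjl).symm
  · exact mul_comm _ _
  · rcases lt_trichotomy j l with hjl | rfl | hjl
    · rw [mul_comm, mul_comm (detx 𝕜 m n i l)]; exact (key k i j l hik hjl).symm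
    · rfl
    · rw [mul_comm, mul_comm (detx 𝕜 m n i l)]; exact key k i l j hik hjl

lemma mk_monomial_eq_of_weight_eq {d e : (Fin m × Fin n) →₀ ℕ} (h : weight d = weight e) :
    Ideal.Quotient.mk (detI2 𝕜 m n) (monomial d 1) =
      Ideal.Quotient.mk (detI2 𝕜 m n) (monomial e 1) := by
  classical
  have hprod : ∀ d : (Fin m × Fin n) →₀ ℕ, Ideal.Quotient.mk (detI2 𝕜 m n) (monomial d 1) =
      (d.toMultiset.map fun c => detx 𝕜 m n c.1 c.2).prod := by
    intro d
    induction d using Finsupp.induction_linear with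
    | zero => simp [monomial_zero_one]
    | add d e h h' =>
      rw [map_add, Multiset.map_add, Multiset.prod_add, ← h, ← h', ← map_mul,
        monomial_mul_monomial, one_mul]
    | single c k =>
      rw [← one_pow k, ← mul_one k, ← smul_eq_mul, ← Finsupp.smul_single, smul_eq_mul, mul_one,
        ← monomial_pow]
      simp [detx, X, Multiset.map_nsmul, Multiset.prod_nsmul]
  rw [hprod, hprod]
  refine prod_eq_of_map_eq _ (fun i k j l => detx_mul_detx i k j l) _ _ ?_ ?_
  · ext i
    rw [← weight_inl, ← weight_inl, h]
  · ext j
    rw [← weight_inr, ← weight_inr, h]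

variable (𝕜 m n) in
/-- The maximal ideal of the determinantal ring, as the ideal of the entries. -/
def entriesIdeal : Ideal (DetR 𝕜 m n) :=
  (Ideal.span (Set.range (X : Fin m × Fin n → DetP 𝕜 m n))).map
    (Ideal.Quotient.mk (detI2 𝕜 m n))

lemma entriesIdeal_ne_top : entriesIdeal 𝕜 m n ≠ ⊤ := by
  rw [Ne, Ideal.eq_top_iff_one, entriesIdeal,
    Ideal.mem_map_iff_of_surjective _ Ideal.Quotient.mk_surjective]
  rintro ⟨f, hf, hf1⟩
  have h0 : constantCoeff f = 0 := by
    have : Ideal.span (Set.range (X : Fin m × Fin n → DetP 𝕜 m n)) ≤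
        RingHom.ker (constantCoeff (σ := Fin m × Fin n) (R := 𝕜)) := by
      rw [Ideal.span_le]
      rintro _ ⟨c, rfl⟩
      simp
    exact this hf
  rw [← map_one (Ideal.Quotient.mk (detI2 𝕜 m n)), Ideal.Quotient.eq] at hf1
  have h1 := constantCoeff_segre (f - 1)
  rw [(RingHom.mem_ker).1 (detI2_le_ker hf1)] at h1
  simp [h0] at h1

lemma mk_coe_eq_zero (q : MvPolynomial (Fin m × Fin n) 𝕜)
    (hq : segre 𝕜 m n (q : DetP 𝕜 m n) = 0) :
    Ideal.Quotient.mk (detI2 𝕜 m n) (q : DetP 𝕜 m n) = 0 := by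
  classical
  let g : ((Fin m ⊕ Fin n) →₀ ℕ) → DetR 𝕜 m n := fun e =>
    if h : ∃ d, weight d = e then Ideal.Quotient.mk _ (monomial h.choose 1) else 0
  have hg : ∀ d, Ideal.Quotient.mk (detI2 𝕜 m n) (monomial d 1) = g (weight d) := by
    intro d
    have h : ∃ d', weight d' = weight d := ⟨d, rfl⟩
    simp only [g, dif_pos h]
    exact mk_monomial_eq_of_weight_eq h.choose_spec.symm
  have hsum : (q : DetP 𝕜 m n) =
      ∑ d ∈ q.support, C (MvPolynomial.coeff d q) * monomial d 1 := by
    ext e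
    simp only [MvPolynomial.coeff_coe, map_sum, coeff_C_mul, coeff_monomial, mul_ite, mul_one,
      mul_zero]
    rw [Finset.sum_ite_eq]
    split_ifs with h
    · rfl
    · simpa using h
  rw [hsum, map_sum]
  simp only [map_mul, hg]
  rw [← Finset.sum_fiberwise_of_maps_to (t := q.support.image weight)
    (fun d hd => Finset.mem_image_of_mem _ hd)]
  refine Finset.sum_eq_zero fun e he => ?_
  have : ∀ d ∈ q.support.filter (fun d => weight d = e),
      Ideal.Quotient.mk (detI2 𝕜 m n) (C (MvPolynomial.coeff d q)) * g (weight d) =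
      Ideal.Quotient.mk (detI2 𝕜 m n) (C (MvPolynomial.coeff d q)) * g e := by
    intro d hd
    rw [(Finset.mem_filter.1 hd).2]
  rw [Finset.sum_congr rfl this, ← Finset.sum_mul, ← map_sum, ← map_sum]
  have hc := congrArg (coeff e) hq
  rw [coeff_segre, map_zero] at hc
  have : ∑ d ∈ q.support.filter (fun d => weight d = e), MvPolynomial.coeff d q = 0 := by
    rw [← hc]
    refine Finset.sum_subset_zero_on_sdiff ?_ ?_ ?_
    · intro d hd
      simpa using (Finset.mem_filter.1 hd).2
    · intro d hd
      simp only [Finset.mem_sdiff, Finset.mem_filter, Set.Finite.mem_toFinset,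
        Set.mem_ofPred_eq, MvPolynomial.mem_support_iff] at hd
      rw [MvPolynomial.coeff_coe]
      by_contra h
      exact hd.2 ⟨h, hd.1⟩
    · intro d _
      rw [MvPolynomial.coeff_coe]
  rw [this, map_zero, map_zero, zero_mul]

lemma segre_eq_zero_iff [IsLocalRing (DetR 𝕜 m n)] (p : DetP 𝕜 m n) :
    segre 𝕜 m n p = 0 ↔ Ideal.Quotient.mk (detI2 𝕜 m n) p = 0 := by
  classical
  constructor
  · intro hp
    have hbot := Ideal.iInf_pow_eq_bot_of_isLocalRing (entriesIdeal 𝕜 m n) entriesIdeal_ne_top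
    suffices h : Ideal.Quotient.mk (detI2 𝕜 m n) p ∈ ⨅ N, entriesIdeal 𝕜 m n ^ N by
      rw [hbot] at h; simpa using h
    rw [Ideal.mem_iInf]
    intro N
    let q : MvPolynomial (Fin m × Fin n) 𝕜 := truncTotal N p
    have hq : segre 𝕜 m n (q : DetP 𝕜 m n) = 0 := by
      ext e
      have hc := congrArg (coeff e) hp
      rw [coeff_segre, map_zero] at hc ⊢
      by_cases he : ∑ i, e (Sum.inl i) < N
      · rw [← hc]
        refine Finset.sum_congr rfl fun d hd => ?_
        have : weight d = e := by simpa using hd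
        rw [MvPolynomial.coeff_coe, coeff_truncTotal]
        rwa [← sum_weight_inl, this]
      · refine Finset.sum_eq_zero fun d hd => ?_
        have : weight d = e := by simpa using hd
        rw [MvPolynomial.coeff_coe, coeff_truncTotal_eq_zero]
        rw [← sum_weight_inl, this]
        omega
    have hsub : Ideal.Quotient.mk (detI2 𝕜 m n) p =
        Ideal.Quotient.mk (detI2 𝕜 m n) (p - (q : DetP 𝕜 m n)) := by
      rw [map_sub, mk_coe_eq_zero q hq, sub_zero]
    rw [hsub, entriesIdeal, ← Ideal.map_pow]
    refine Ideal.mem_map_of_mem _ (mem_pow_of_coeff_eq_zero N _ fun d hd => ?_)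
    rw [map_sub, MvPolynomial.coeff_coe, coeff_truncTotal _ hd, sub_self]
  · intro hp
    exact detI2_le_ker (Ideal.Quotient.eq_zero_iff_mem.1 hp)

lemma exists_segre_eq (f : MvPowerSeries (Fin m ⊕ Fin n) 𝕜)
    (hf : ∀ e, coeff e f ≠ 0 → ∑ i, e (Sum.inl i) = ∑ j, e (Sum.inr j)) :
    ∃ p, segre 𝕜 m n p = f := by
  classical
  have hsec : ∃ s : ((Fin m ⊕ Fin n) →₀ ℕ) → ((Fin m × Fin n) →₀ ℕ),
      ∀ e, ∑ i, e (Sum.inl i) = ∑ j, e (Sum.inr j) → weight (s e) = e := by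
    choose s hs using exists_weight_eq (m := m) (n := n)
    exact ⟨fun e => if h : _ then s e h else 0, fun e h => by simp only [dif_pos h]; exact hs e h⟩
  obtain ⟨s, hs⟩ := hsec
  let p : DetP 𝕜 m n := fun d => if d = s (weight d) then coeff (weight d) f else 0
  have hp : ∀ d, coeff d p = if d = s (weight d) then coeff (weight d) f else 0 := fun d => rfl
  refine ⟨p, ?_⟩
  ext e
  rw [coeff_segre]
  have : ∀ d ∈ (finite_weight_eq e).toFinset, coeff d p = if d = s e then coeff e f else 0 := by
    intro d hd
    have : weight d = e := by simpa using hd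
    rw [hp, this]
  rw [Finset.sum_congr rfl this, Finset.sum_ite_eq']
  split_ifs with h
  · rfl
  · by_contra h'
    exact h (by simpa using hs e (hf e (Ne.symm h')))

end Segre

namespace Segre

/-- Exponents of Laurent monomials in the `u_i` and `v_j`. -/
abbrev Exponent := (Fin m ⊕ Fin n) → ℤ

/-- Laurent series in the `u_i` and `v_j`. -/
abbrev Laurent := HahnSeries (Exponent m n) 𝕜

/-- Natural exponents as integral exponents. -/
def castExponent : ((Fin m ⊕ Fin n) →₀ ℕ) →+ Exponent m n where
  toFun e c := e c
  map_zero' := by ext; simp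
  map_add' e f := by ext; simp

variable {m n}

lemma castExponent_apply (e : (Fin m ⊕ Fin n) →₀ ℕ) (c : Fin m ⊕ Fin n) :
    castExponent m n e c = e c := rfl

lemma castExponent_injective : Function.Injective (castExponent m n) := by
  intro e f h
  ext c
  have := congrFun h c
  simpa [castExponent_apply] using this

lemma castExponent_le_iff (e f : (Fin m ⊕ Fin n) →₀ ℕ) :
    castExponent m n e ≤ castExponent m n f ↔ e ≤ f := by
  simp [Pi.le_def, Finsupp.le_def, castExponent_apply]

lemma exists_castExponent_eq {g : Exponent m n} (hg : 0 ≤ g) : ∃ e, castExponent m n e = g := by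
  refine ⟨Finsupp.equivFunOnFinite.symm fun c => (g c).toNat, ?_⟩
  ext c
  rw [castExponent_apply]
  simpa using hg c

variable {𝕜}

/-- Power series as Laurent series. -/
def toLaurent : MvPowerSeries (Fin m ⊕ Fin n) 𝕜 →+* Laurent 𝕜 m n :=
  (HahnSeries.embDomainRingHom (castExponent m n) castExponent_injective castExponent_le_iff).comp
    (HahnSeries.toMvPowerSeries (R := 𝕜) (σ := Fin m ⊕ Fin n)).symm.toRingHom

lemma coeff_toLaurent (f : MvPowerSeries (Fin m ⊕ Fin n) 𝕜) (e : (Fin m ⊕ Fin n) →₀ ℕ) :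
    (toLaurent f).coeff (castExponent m n e) = coeff e f :=
  HahnSeries.embDomain_coeff (f := ⟨⟨castExponent m n, castExponent_injective⟩,
    castExponent_le_iff _ _⟩) (x := HahnSeries.toMvPowerSeries.symm f) (a := e)

lemma coeff_toLaurent_of_not_nonneg (f : MvPowerSeries (Fin m ⊕ Fin n) 𝕜) {g : Exponent m n}
    (hg : ¬ 0 ≤ g) : (toLaurent f).coeff g = 0 := by
  refine HahnSeries.embDomain_of_notMem_range (f := ⟨⟨castExponent m n, castExponent_injective⟩,
    castExponent_le_iff _ _⟩) (x := HahnSeries.toMvPowerSeries.symm f) ?_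
  rintro ⟨e, rfl⟩
  exact hg fun c => by simp [castExponent_apply]

lemma toLaurent_injective : Function.Injective (toLaurent (𝕜 := 𝕜) (m := m) (n := n)) := by
  intro f f' h
  ext e
  rw [← coeff_toLaurent, h, coeff_toLaurent]

lemma toLaurent_monomial (e : (Fin m ⊕ Fin n) →₀ ℕ) (a : 𝕜) :
    toLaurent (monomial e a) = HahnSeries.single (castExponent m n e) a := by
  classical
  ext g
  by_cases hg : 0 ≤ g
  · obtain ⟨d, rfl⟩ := exists_castExponent_eq hg
    rw [coeff_toLaurent, coeff_monomial, HahnSeries.coeff_single]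
    simp [castExponent_injective.eq_iff]
  · rw [coeff_toLaurent_of_not_nonneg _ hg, HahnSeries.coeff_single_of_ne]
    rintro rfl
    exact hg fun c => by simp [castExponent_apply]

/-- Exponents of equal total degree in the `u_i` and in the `v_j`. -/
def Balanced (g : Exponent m n) : Prop := ∑ i, g (Sum.inl i) = ∑ j, g (Sum.inr j)

lemma balanced_castExponent_iff (e : (Fin m ⊕ Fin n) →₀ ℕ) :
    Balanced (castExponent m n e) ↔ ∑ i, e (Sum.inl i) = ∑ j, e (Sum.inr j) := by
  simp only [Balanced, castExponent_apply]
  exact_mod_cast Iff.rfl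

lemma Balanced.add {g h : Exponent m n} (hg : Balanced g) (hh : Balanced h) :
    Balanced (g + h) := by
  simp only [Balanced, Pi.add_apply, Finset.sum_add_distrib] at *
  rw [hg, hh]

lemma Balanced.neg {g : Exponent m n} (hg : Balanced g) : Balanced (-g) := by
  simp only [Balanced, Pi.neg_apply, Finset.sum_neg_distrib] at *
  rw [hg]

variable (𝕜 m n) in
/-- The determinantal ring as a ring of Laurent series. -/
def phi : DetR 𝕜 m n →+* Laurent 𝕜 m n :=
  Ideal.Quotient.lift (detI2 𝕜 m n) (toLaurent.comp (segre 𝕜 m n).toRingHom) fun p hp => by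
    have : segre 𝕜 m n p = 0 := detI2_le_ker hp
    simp [this]

lemma phi_mk (p : DetP 𝕜 m n) :
    phi 𝕜 m n (Ideal.Quotient.mk _ p) = toLaurent (segre 𝕜 m n p) := rfl

/-- The exponent of `u_i v_j`. -/
def unitExponent (i : Fin m) (j : Fin n) : Exponent m n :=
  Pi.single (Sum.inl i) 1 + Pi.single (Sum.inr j) 1

lemma phi_detx (i : Fin m) (j : Fin n) :
    phi 𝕜 m n (detx 𝕜 m n i j) = HahnSeries.single (unitExponent i j) 1 := by
  classical
  rw [detx, phi_mk, segre_X, toLaurent_monomial]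
  have : castExponent m n (unitWeight (i, j)) = unitExponent i j := by
    funext c
    simp [castExponent_apply, unitWeight, unitExponent, Finsupp.single_apply, Pi.single_apply,
      eq_comm]
  rw [this]

lemma balanced_unitExponent (i : Fin m) (j : Fin n) : Balanced (unitExponent i j) := by
  simp [Balanced, unitExponent, Pi.single_apply]

lemma phi_injective [IsLocalRing (DetR 𝕜 m n)] : Function.Injective (phi 𝕜 m n) := by
  rw [injective_iff_map_eq_zero]
  intro r hr
  obtain ⟨p, rfl⟩ := Ideal.Quotient.mk_surjective r
  rw [phi_mk] at hr
  exact (segre_eq_zero_iff p).1 (toLaurent_injective (hr.trans (map_zero _).symm))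

lemma nonneg_of_coeff_phi_ne_zero {r : DetR 𝕜 m n} {g : Exponent m n}
    (hg : (phi 𝕜 m n r).coeff g ≠ 0) : 0 ≤ g := by
  obtain ⟨p, rfl⟩ := Ideal.Quotient.mk_surjective r
  by_contra h
  exact hg (coeff_toLaurent_of_not_nonneg _ h)

lemma balanced_of_coeff_phi_ne_zero {r : DetR 𝕜 m n} {g : Exponent m n}
    (hg : (phi 𝕜 m n r).coeff g ≠ 0) : Balanced g := by
  obtain ⟨e, rfl⟩ := exists_castExponent_eq (nonneg_of_coeff_phi_ne_zero hg)
  obtain ⟨p, rfl⟩ := Ideal.Quotient.mk_surjective r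
  rw [phi_mk, coeff_toLaurent, coeff_segre] at hg
  obtain ⟨d, hd, -⟩ := Finset.exists_ne_zero_of_sum_ne_zero hg
  have : weight d = e := by simpa using hd
  rw [balanced_castExponent_iff, ← this, sum_weight_inl, sum_weight_inr]

lemma exists_phi_eq (f : Laurent 𝕜 m n) (hf : ∀ g, f.coeff g ≠ 0 → 0 ≤ g ∧ Balanced g) :
    ∃ r, phi 𝕜 m n r = f := by
  let f' : MvPowerSeries (Fin m ⊕ Fin n) 𝕜 := fun e => f.coeff (castExponent m n e)
  have hf' : ∀ e, coeff e f' = f.coeff (castExponent m n e) := fun e => rfl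
  obtain ⟨p, hp⟩ := exists_segre_eq f' fun e he =>
    (balanced_castExponent_iff e).1 (hf _ (by rwa [hf'] at he)).2
  refine ⟨Ideal.Quotient.mk _ p, ?_⟩
  rw [phi_mk, hp]
  ext g
  by_cases hg : 0 ≤ g
  · obtain ⟨d, rfl⟩ := exists_castExponent_eq hg
    rw [coeff_toLaurent, hf']
  · rw [coeff_toLaurent_of_not_nonneg _ hg]
    by_contra h
    exact hg (hf g (Ne.symm h)).1

/-- Elements of the maximal ideal have no constant term. -/
lemma coeff_phi_zero [IsLocalRing (DetR 𝕜 m n)] {r : DetR 𝕜 m n}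
    (hr : r ∈ IsLocalRing.maximalIdeal (DetR 𝕜 m n)) : (phi 𝕜 m n r).coeff 0 = 0 := by
  obtain ⟨p, rfl⟩ := Ideal.Quotient.mk_surjective r
  rw [phi_mk, ← map_zero (castExponent m n), coeff_toLaurent, coeff_zero_eq_constantCoeff_apply,
    constantCoeff_segre]
  by_contra h
  have hu : IsUnit p := isUnit_iff_constantCoeff.2 (isUnit_iff_ne_zero.2 h)
  exact (IsLocalRing.mem_maximalIdeal _).1 hr (hu.map _)

lemma exists_coeff_ne_zero_of_mul {f h : Laurent 𝕜 m n} {g : Exponent m n}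
    (hg : (f * h).coeff g ≠ 0) : ∃ a b, f.coeff a ≠ 0 ∧ h.coeff b ≠ 0 ∧ a + b = g := by
  obtain ⟨a, ha, b, hb, rfl⟩ := Set.mem_add.1 (HahnSeries.support_mul_subset hg)
  exact ⟨a, b, ha, hb, rfl⟩

/-- Elements of the `N`-th power of the ideal of the first columns have large degree in the
corresponding variables. -/
lemma le_of_coeff_phi_ne_zero {r : DetR 𝕜 m n} {N : ℕ} (hr : r ∈ detJ 𝕜 m n ^ N)
    {g : Exponent m n} (hg : (phi 𝕜 m n r).coeff g ≠ 0) :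
    (N : ℤ) ≤ ∑ j : Fin n, if (j : ℕ) < n - 1 then g (Sum.inr j) else 0 := by
  classical
  let deg : Exponent m n →+ ℤ :=
    { toFun := fun g => ∑ j : Fin n, if (j : ℕ) < n - 1 then g (Sum.inr j) else 0
      map_zero' := by simp
      map_add' := fun a b => by
        rw [← Finset.sum_add_distrib]
        refine Finset.sum_congr rfl fun j _ => ?_
        split_ifs <;> simp }
  have hdeg : ∀ g, 0 ≤ g → 0 ≤ deg g := fun g hg => by
    change 0 ≤ ∑ j : Fin n, if (j : ℕ) < n - 1 then g (Sum.inr j) else 0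
    refine Finset.sum_nonneg fun j _ => ?_
    split_ifs
    · exact hg _
    · exact le_rfl
  change (N : ℤ) ≤ deg g
  induction N generalizing r g with
  | zero => exact_mod_cast hdeg g (nonneg_of_coeff_phi_ne_zero hg)
  | succ N ih =>
    have hone : ∀ {y : DetR 𝕜 m n}, y ∈ detJ 𝕜 m n → ∀ g, (phi 𝕜 m n y).coeff g ≠ 0 →
        1 ≤ deg g := by
      intro y hy
      refine Submodule.span_induction (p := fun y _ => ∀ g, (phi 𝕜 m n y).coeff g ≠ 0 →
        1 ≤ deg g) ?_ ?_ ?_ ?_ hy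
      · rintro _ ⟨i, j, hj, rfl⟩ g hg
        rw [phi_detx] at hg
        have : g = unitExponent i j := by
          by_contra h
          exact hg (HahnSeries.coeff_single_of_ne h)
        subst this
        have : deg (unitExponent i j) = 1 := by
          change ∑ k : Fin n, _ = _
          rw [Finset.sum_eq_single_of_mem j (Finset.mem_univ _)]
          · simp [unitExponent, hj]
          · intro k _ hk
            simp [unitExponent, hk]
        exact this.ge
      · intro g hg
        simp at hg
      · intro x y _ _ hx hy g hg
        rw [map_add, HahnSeries.coeff_add] at hg
        by_cases h : (phi 𝕜 m n x).coeff g = 0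
        · exact hy g (by simpa [h] using hg)
        · exact hx g h
      · intro a x _ hx g hg
        rw [smul_eq_mul, map_mul] at hg
        obtain ⟨b, c, hb, hc, rfl⟩ := exists_coeff_ne_zero_of_mul hg
        rw [map_add]
        have := hdeg b (nonneg_of_coeff_phi_ne_zero hb)
        have := hx c hc
        omega
    replace hr : r ∈ detJ 𝕜 m n ^ N * detJ 𝕜 m n := hr
    refine Submodule.mul_induction_on' (C := fun r _ => ∀ g, (phi 𝕜 m n r).coeff g ≠ 0 →
      ((N + 1 : ℕ) : ℤ) ≤ deg g) ?_ ?_ hr g hg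
    · intro x hx y hy g hg
      rw [map_mul] at hg
      obtain ⟨b, c, hb, hc, rfl⟩ := exists_coeff_ne_zero_of_mul hg
      have h1 := ih hx hb
      have h2 := hone hy c hc
      rw [map_add]
      push_cast
      omega
    · intro x _ y _ hx hy g hg
      rw [map_add, HahnSeries.coeff_add] at hg
      by_cases h : (phi 𝕜 m n x).coeff g = 0
      · exact hy g (by simpa [h] using hg)
      · exact hx g h

lemma exists_lower_bound (f : Laurent 𝕜 m n) :
    ∃ C : ℤ, ∀ g, f.coeff g ≠ 0 → ∀ c, C ≤ g c := by
  have h : ∀ c : Fin m ⊕ Fin n, ∃ C : ℤ, ∀ g, f.coeff g ≠ 0 → C ≤ g c := by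
    intro c
    have hP : ((fun g : Exponent m n => g c) '' f.support).IsPWO :=
      f.isPWO_support.image_of_monotone (fun a b hab => hab c)
    rcases (f.support).eq_empty_or_nonempty with he | hne
    · refine ⟨0, fun g hg => ?_⟩
      have : g ∈ f.support := hg
      rw [he] at this
      exact this.elim
    · exact ⟨hP.isWF.min (hne.image _), fun g hg => hP.isWF.min_le _ ⟨g, hg, rfl⟩⟩
  choose C hC using h
  refine ⟨-∑ c, |C c|, fun g hg c => ?_⟩
  have h1 := Finset.single_le_sum (f := fun c => |C c|) (fun c _ => abs_nonneg _)
    (Finset.mem_univ c)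
  have h2 := neg_abs_le (C c)
  have h3 := hC c g hg
  omega

end Segre

namespace Segre

/-- Laurent series as a module over the determinantal ring. -/
instance laurentModule : Module (DetR 𝕜 m n) (Laurent 𝕜 m n) :=
  Module.compHom _ (phi 𝕜 m n)

variable {𝕜 m n}

lemma smul_laurent (r : DetR 𝕜 m n) (f : Laurent 𝕜 m n) : r • f = phi 𝕜 m n r * f := rfl

/-- The restriction of a Laurent series to a set of exponents. -/
def restrict (D : Set (Exponent m n)) (f : Laurent 𝕜 m n) : Laurent 𝕜 m n := by
  classical
  exact
    { coeff := fun g => if g ∈ D then f.coeff g else 0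
      isPWO_support' := f.isPWO_support.mono fun g hg => by
        by_contra h
        have : f.coeff g = 0 := by simpa using h
        simp [this] at hg }

lemma coeff_restrict_of_mem {D : Set (Exponent m n)} (f : Laurent 𝕜 m n) {g : Exponent m n}
    (hg : g ∈ D) : (restrict D f).coeff g = f.coeff g := if_pos hg

lemma coeff_restrict_of_notMem {D : Set (Exponent m n)} (f : Laurent 𝕜 m n) {g : Exponent m n}
    (hg : g ∉ D) : (restrict D f).coeff g = 0 := if_neg hg

/-- Sets of coordinates. -/
abbrev Coords (m n : ℕ) := Set (Fin m ⊕ Fin n)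

/-- A set of exponents stable under the exponents of elements of the determinantal ring. -/
def IsStable (D : Set (Exponent m n)) : Prop :=
  ∀ g ∈ D, ∀ u : Exponent m n, 0 ≤ u → Balanced u → u + g ∈ D

variable (𝕜) in
/-- The Laurent series supported in a stable set of exponents. -/
def supportedIn (D : Set (Exponent m n)) (hD : IsStable D) :
    Submodule (DetR 𝕜 m n) (Laurent 𝕜 m n) where
  carrier := {f | ∀ g, f.coeff g ≠ 0 → g ∈ D}
  zero_mem' g hg := by simp at hg
  add_mem' {f f'} hf hf' g hg := by
    rw [HahnSeries.coeff_add] at hg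
    by_cases h : f.coeff g = 0
    · exact hf' g (by simpa [h] using hg)
    · exact hf g h
  smul_mem' r f hf g hg := by
    rw [smul_laurent] at hg
    obtain ⟨a, b, ha, hb, rfl⟩ := exists_coeff_ne_zero_of_mul hg
    exact hD b (hf b hb) a (nonneg_of_coeff_phi_ne_zero ha) (balanced_of_coeff_phi_ne_zero ha)

/-- Balanced exponents which are nonnegative at the coordinates in `P`. -/
def region (P : Coords m n) : Set (Exponent m n) :=
  {g | Balanced g ∧ ∀ c ∈ P, 0 ≤ g c}

/-- Exponents which are nonnegative at some coordinate in `M`. -/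
def cut (M : Coords m n) : Set (Exponent m n) := {g | ∃ c ∈ M, 0 ≤ g c}

lemma isStable_region (P : Coords m n) : IsStable (region P) :=
  fun _ hg _ hu hb => ⟨hb.add hg.1, fun c hc => add_nonneg (hu c) (hg.2 c hc)⟩

lemma isStable_cut (M : Coords m n) : IsStable (cut M) := by
  rintro g ⟨c, hc, hg⟩ _ hu -
  exact ⟨c, hc, add_nonneg (hu c) hg⟩

variable (𝕜) in
/-- The series supported in `region P`. -/
abbrev regionModule (P : Coords m n) : Submodule (DetR 𝕜 m n) (Laurent 𝕜 m n) :=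
  supportedIn 𝕜 (region P) (isStable_region P)

variable (𝕜) in
/-- The series supported in `cut M`. -/
abbrev cutModule (M : Coords m n) : Submodule (DetR 𝕜 m n) (Laurent 𝕜 m n) :=
  supportedIn 𝕜 (cut M) (isStable_cut M)

variable (𝕜) in
/-- The series supported in `region P`, modulo those supported in `cut M`. -/
abbrev Sector (P M : Coords m n) : Type :=
  regionModule 𝕜 P ⧸ (cutModule 𝕜 M).comap (regionModule 𝕜 P).subtype

variable (𝕜) in
/-- The sector modules as objects of the category of modules. -/
abbrev sector (P M : Coords m n) : ModuleCat.{0} (DetR 𝕜 m n) :=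
  ModuleCat.of (DetR 𝕜 m n) (Sector 𝕜 P M)

/-- The class of a series in a sector. -/
def toSector {P : Coords m n} (M : Coords m n) (f : Laurent 𝕜 m n)
    (hf : f ∈ regionModule 𝕜 P) : Sector 𝕜 P M :=
  Submodule.Quotient.mk ⟨f, hf⟩

lemma toSector_eq_zero_iff {P M : Coords m n} {f : Laurent 𝕜 m n}
    {hf : f ∈ regionModule 𝕜 P} : toSector M f hf = 0 ↔ f ∈ cutModule 𝕜 M :=
  (Submodule.Quotient.mk_eq_zero _)

lemma exists_toSector_eq {P M : Coords m n} (x : Sector 𝕜 P M) : ∃ f hf, toSector M f hf = x := by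
  obtain ⟨⟨f, hf⟩, rfl⟩ := Submodule.Quotient.mk_surjective _ x
  exact ⟨f, hf, rfl⟩

lemma smul_toSector {P M : Coords m n} (r : DetR 𝕜 m n) (f : Laurent 𝕜 m n)
    (hf : f ∈ regionModule 𝕜 P) :
    r • toSector M f hf = toSector M (r • f) (Submodule.smul_mem _ r hf) := rfl

lemma region_anti {P P' : Coords m n} (h : P' ⊆ P) : region P ⊆ region P' :=
  fun _ hg => ⟨hg.1, fun c hc => hg.2 c (h hc)⟩

lemma cut_mono {M M' : Coords m n} (h : M ⊆ M') : cut M ⊆ cut M' := by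
  rintro g ⟨c, hc, hg⟩
  exact ⟨c, h hc, hg⟩

lemma regionModule_anti {P P' : Coords m n} (h : P' ⊆ P) :
    regionModule 𝕜 P ≤ regionModule 𝕜 P' := fun _ hf g hg => region_anti h (hf g hg)

/-- The natural map between sectors. -/
def sectorMap {P P' M M' : Coords m n} (hP : P' ⊆ P) (hM : M ⊆ M') :
    sector 𝕜 P M ⟶ sector 𝕜 P' M' :=
  ModuleCat.ofHom (Submodule.mapQ _ _ (Submodule.inclusion (regionModule_anti hP))
    fun _ hf g hg => cut_mono hM (hf g hg))

section Sequence

variable {P P₁ M M₁ : Coords m n} (c : Fin m ⊕ Fin n) (hP : P₁ = insert c P)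
  (hM : M₁ = insert c M)

variable (𝕜) in
/-- The sequence obtained by splitting a sector according to the sign of the coordinate `c`. -/
def sectorSequence : ShortComplex (ModuleCat.{0} (DetR 𝕜 m n)) where
  X₁ := sector 𝕜 P₁ M
  X₂ := sector 𝕜 P M
  X₃ := sector 𝕜 P M₁
  f := sectorMap (hP ▸ Set.subset_insert c P) subset_rfl
  g := sectorMap subset_rfl (hM ▸ Set.subset_insert c M)
  zero := by
    subst hP hM
    ext ⟨f, hf⟩
    refine (toSector_eq_zero_iff (hf := regionModule_anti (Set.subset_insert c P) hf)).2 ?_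
    intro g hg
    exact ⟨c, Set.mem_insert _ _, (hf g hg).2 c (Set.mem_insert _ _)⟩

lemma sectorSequence_shortExact : (sectorSequence 𝕜 c hP hM).ShortExact := by
  subst hP hM
  refine ShortComplex.ShortExact.mk' ?_ ?_ ?_
  · rw [ShortComplex.moduleCat_exact_iff]
    intro x hx
    obtain ⟨f, hf, rfl⟩ := exists_toSector_eq (𝕜 := 𝕜) x
    replace hx := (toSector_eq_zero_iff (M := insert c M) (hf := hf)).1 hx
    let D : Set (Exponent m n) := {g | 0 ≤ g c}
    have hres : restrict D f ∈ regionModule 𝕜 (insert c P) := by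
      intro g hg
      by_cases h : g ∈ D
      · rw [coeff_restrict_of_mem _ h] at hg
        refine ⟨(hf g hg).1, ?_⟩
        rintro d (rfl | hd)
        · exact h
        · exact (hf g hg).2 d hd
      · exact absurd (coeff_restrict_of_notMem _ h) hg
    refine ⟨toSector M (restrict D f) hres, ?_⟩
    refine (Submodule.Quotient.eq _).2 ?_
    change restrict D f - f ∈ cutModule 𝕜 M
    intro g hg
    rw [HahnSeries.coeff_sub] at hg
    by_cases h : g ∈ D
    · rw [coeff_restrict_of_mem _ h, sub_self] at hg
      exact absurd rfl hg
    · rw [coeff_restrict_of_notMem _ h, zero_sub, neg_ne_zero] at hg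
      obtain ⟨d, rfl | hd, hdg⟩ := hx g hg
      · exact absurd hdg h
      · exact ⟨d, hd, hdg⟩
  · rw [ModuleCat.mono_iff_injective]
    rw [injective_iff_map_eq_zero]
    intro x hx
    obtain ⟨f, hf, rfl⟩ := exists_toSector_eq (𝕜 := 𝕜) x
    replace hx := (toSector_eq_zero_iff (M := M)
      (hf := regionModule_anti (Set.subset_insert c P) hf)).1 hx
    exact (toSector_eq_zero_iff (hf := hf)).2 hx
  · rw [ModuleCat.epi_iff_surjective]
    intro x
    obtain ⟨f, hf, rfl⟩ := exists_toSector_eq x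
    exact ⟨toSector M f hf, rfl⟩

end Sequence

/-- The entry `x_{ij}` acts bijectively on sectors not involving the coordinates `i` and `j`. -/
lemma bijective_detx {P M : Coords m n} (i : Fin m) (j : Fin n)
    (hiP : Sum.inl i ∉ P) (hiM : Sum.inl i ∉ M) (hjP : Sum.inr j ∉ P) (hjM : Sum.inr j ∉ M) :
    Function.Bijective fun y : sector 𝕜 P M => detx 𝕜 m n i j • y := by
  have hu : ∀ c, c ∈ P ∨ c ∈ M → unitExponent i j c = 0 := by
    intro c hc
    have h1 : c ≠ Sum.inl i := by rintro rfl; tauto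
    have h2 : c ≠ Sum.inr j := by rintro rfl; tauto
    simp [unitExponent, h1, h2]
  constructor
  · refine (injective_iff_map_eq_zero (DistribSMul.toAddMonoidHom (sector 𝕜 P M)
      (detx 𝕜 m n i j))).2 fun x hx => ?_
    obtain ⟨f, hf, rfl⟩ := exists_toSector_eq x
    change detx 𝕜 m n i j • toSector M f hf = 0 at hx
    rw [smul_toSector, toSector_eq_zero_iff, smul_laurent, phi_detx] at hx
    rw [toSector_eq_zero_iff]
    intro g hg
    obtain ⟨c, hc, hcg⟩ := hx (g + unitExponent i j) (by
      rw [HahnSeries.coeff_single_mul_add, one_mul]; exact hg)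
    refine ⟨c, hc, ?_⟩
    rwa [Pi.add_apply, hu c (Or.inr hc), add_zero] at hcg
  · intro x
    obtain ⟨f, hf, rfl⟩ := exists_toSector_eq x
    have hmem : HahnSeries.single (-unitExponent i j) (1 : 𝕜) * f ∈ regionModule 𝕜 P := by
      intro g hg
      rw [HahnSeries.coeff_single_mul, one_mul, sub_neg_eq_add] at hg
      have h := hf _ hg
      refine ⟨?_, fun c hc => ?_⟩
      · have := h.1.add (balanced_unitExponent i j).neg
        rwa [add_neg_cancel_right] at this
      · have := h.2 c hc
        rwa [Pi.add_apply, hu c (Or.inl hc), add_zero] at this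
    refine ⟨toSector M _ hmem, ?_⟩
    change detx 𝕜 m n i j • toSector M _ _ = _
    rw [smul_toSector]
    congr 1
    rw [smul_laurent, phi_detx, ← mul_assoc, HahnSeries.single_mul_single, add_neg_cancel,
      one_mul]
    exact one_mul f

/-- Sectors that are cut along all rows, or along the first columns, are torsion. -/
lemma isPowTorsion_sector {P M : Coords m n} (hm : 0 < m) (hn : 1 < n)
    (h : (∀ i, Sum.inl i ∈ M) ∨ ∀ j : Fin n, (j : ℕ) < n - 1 → Sum.inr j ∈ M) :
    TorsionExt.IsPowTorsion (detJ 𝕜 m n) (Sector 𝕜 P M) := by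
  intro y
  obtain ⟨f, hf, rfl⟩ := exists_toSector_eq y
  obtain ⟨C, hC⟩ := exists_lower_bound f
  refine ⟨(m + n) * C.natAbs, fun r hr => ?_⟩
  rw [smul_toSector, toSector_eq_zero_iff]
  intro g hg
  rw [smul_laurent] at hg
  obtain ⟨a, b, ha, hb, rfl⟩ := exists_coeff_ne_zero_of_mul hg
  have hN := le_of_coeff_phi_ne_zero hr ha
  have ha0 := nonneg_of_coeff_phi_ne_zero ha
  have hbal : ∑ i, a (Sum.inl i) = ∑ j, a (Sum.inr j) := balanced_of_coeff_phi_ne_zero ha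
  push_cast at hN
  have hCabs : ∀ c, -|C| ≤ b c := fun c => (neg_abs_le C).trans (hC b hb c)
  by_contra hcut
  have hneg : ∀ c ∈ M, (a + b) c ≤ -1 := fun c hc => by
    by_contra h'
    exact hcut ⟨c, hc, by omega⟩
  rcases h with h | h
  · have h1 : ∑ i : Fin m, (a + b) (Sum.inl i) ≤ ∑ _i : Fin m, (-1 : ℤ) :=
      Finset.sum_le_sum fun i _ => hneg _ (h i)
    have h2 : ∑ _i : Fin m, (-|C|) ≤ ∑ i : Fin m, b (Sum.inl i) :=
      Finset.sum_le_sum fun i _ => hCabs _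
    have h3 : (∑ j : Fin n, if (j : ℕ) < n - 1 then a (Sum.inr j) else 0) ≤
        ∑ j : Fin n, a (Sum.inr j) := by
      refine Finset.sum_le_sum fun j _ => ?_
      split_ifs
      · exact le_rfl
      · exact ha0 _
    simp only [Pi.add_apply, Finset.sum_add_distrib, Finset.sum_const, Finset.card_univ,
      Fintype.card_fin, nsmul_eq_mul] at h1 h2
    have h4 : (0 : ℤ) ≤ n * |C| := by positivity
    have h5 : (0 : ℤ) < m := by exact_mod_cast hm
    nlinarith
  · have h1 : (∑ j : Fin n, if (j : ℕ) < n - 1 then (a + b) (Sum.inr j) else 0) ≤ -1 := by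
      have hn0 : (⟨0, by omega⟩ : Fin n) ∈ Finset.univ := Finset.mem_univ _
      rw [← Finset.add_sum_erase _ _ hn0, if_pos (by simp; omega)]
      have h2 := hneg _ (h ⟨0, by omega⟩ (by simp; omega))
      have h3 : (∑ j ∈ Finset.univ.erase (⟨0, by omega⟩ : Fin n),
          if (j : ℕ) < n - 1 then (a + b) (Sum.inr j) else 0) ≤ 0 := by
        refine Finset.sum_nonpos fun j _ => ?_
        split_ifs with hj
        · have := hneg _ (h j hj)
          omega
        · exact le_rfl
      omega
    have h2 : ∑ _j : Fin n, (-|C|) ≤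
        ∑ j : Fin n, if (j : ℕ) < n - 1 then b (Sum.inr j) else 0 := by
      refine Finset.sum_le_sum fun j _ => ?_
      split_ifs
      · exact hCabs _
      · simp
    have h3 : (∑ j : Fin n, if (j : ℕ) < n - 1 then (a + b) (Sum.inr j) else 0) =
        (∑ j : Fin n, if (j : ℕ) < n - 1 then a (Sum.inr j) else 0) +
        ∑ j : Fin n, if (j : ℕ) < n - 1 then b (Sum.inr j) else 0 := by
      rw [← Finset.sum_add_distrib]
      refine Finset.sum_congr rfl fun j _ => ?_
      split_ifs <;> simp
    simp only [Finset.sum_const, Finset.card_univ, Fintype.card_fin, nsmul_eq_mul] at h2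
    have h4 : (0 : ℤ) ≤ m * |C| := by positivity
    nlinarith

/-- The determinantal ring is the sector where all coordinates are nonnegative. -/
lemma exists_iso_sector [IsLocalRing (DetR 𝕜 m n)] {P M : Coords m n} (hP : ∀ c, c ∈ P)
    (hM : ∀ c, c ∉ M) :
    Nonempty (sector 𝕜 P M ≅ ModuleCat.of (DetR 𝕜 m n) (DetR 𝕜 m n)) := by
  have hmem : ∀ r, phi 𝕜 m n r ∈ regionModule 𝕜 P := fun r g hg =>
    ⟨balanced_of_coeff_phi_ne_zero hg, fun c _ => nonneg_of_coeff_phi_ne_zero hg c⟩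
  let F : DetR 𝕜 m n →ₗ[DetR 𝕜 m n] Sector 𝕜 P M :=
    { toFun := fun r => toSector M (phi 𝕜 m n r) (hmem r)
      map_add' := fun r s => by
        refine (congrArg Submodule.Quotient.mk (Subtype.ext (map_add _ r s)))
      map_smul' := fun r s => by
        rw [RingHom.id_apply, smul_toSector]
        refine (congrArg Submodule.Quotient.mk (Subtype.ext (map_mul _ r s))) }
  have hF : Function.Bijective F := by
    constructor
    · rw [injective_iff_map_eq_zero]
      intro r hr
      have h := toSector_eq_zero_iff.1 hr
      refine phi_injective ?_
      rw [map_zero]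
      ext g
      by_contra hg
      obtain ⟨c, hc, -⟩ := h g hg
      exact hM c hc
    · intro x
      obtain ⟨f, hf, rfl⟩ := exists_toSector_eq x
      obtain ⟨r, rfl⟩ := exists_phi_eq f fun g hg => ⟨fun c => (hf g hg).2 c (hP c), (hf g hg).1⟩
      exact ⟨r, rfl⟩
  exact ⟨(LinearEquiv.ofBijective F hF).symm.toModuleIso⟩

end Segre

namespace Segre
open TorsionExt
variable {m n}

/-- The set `P` together with the rows from the `k`-th on. -/
def rowsFrom (P : Coords m n) (k : ℕ) : Coords m n := P ∪ {c | ∃ i : Fin m, c = Sum.inl i ∧ k ≤ i}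

/-- The set `M` together with the rows before the `k`-th. -/
def rowsUpTo (M : Coords m n) (k : ℕ) : Coords m n := M ∪ {c | ∃ i : Fin m, c = Sum.inl i ∧ ↑i < k}

lemma rowsFrom_eq_insert (P : Coords m n) (i : Fin m) :
    rowsFrom P i = insert (Sum.inl i) (rowsFrom P (i + 1)) := by
  ext c
  simp only [rowsFrom, Set.mem_union, Set.mem_ofPred_eq, Set.mem_insert_iff]
  constructor
  · rintro (h | ⟨l, rfl, hl⟩)
    · exact Or.inr (Or.inl h)
    · rcases eq_or_lt_of_le hl with h | h
      · exact Or.inl (congrArg _ (Fin.ext h.symm))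
      · exact Or.inr (Or.inr ⟨l, rfl, h⟩)
  · rintro (rfl | h | ⟨l, rfl, hl⟩)
    · exact Or.inr ⟨i, rfl, le_rfl⟩
    · exact Or.inl h
    · exact Or.inr ⟨l, rfl, by omega⟩

lemma rowsUpTo_eq_insert (M : Coords m n) (i : Fin m) :
    rowsUpTo M (i + 1) = insert (Sum.inl i) (rowsUpTo M i) := by
  ext c
  simp only [rowsUpTo, Set.mem_union, Set.mem_ofPred_eq, Set.mem_insert_iff]
  constructor
  · rintro (h | ⟨l, rfl, hl⟩)
    · exact Or.inr (Or.inl h)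
    · rcases eq_or_lt_of_le (Nat.lt_succ_iff.1 hl) with h | h
      · exact Or.inl (congrArg _ (Fin.ext h))
      · exact Or.inr (Or.inr ⟨l, rfl, h⟩)
  · rintro (rfl | h | ⟨l, rfl, hl⟩)
    · exact Or.inr ⟨i, rfl, Nat.lt_succ_self _⟩
    · exact Or.inl h
    · exact Or.inr ⟨l, rfl, by omega⟩

lemma rowsFrom_mono {P P' : Coords m n} (h : P' ⊆ P) (k : ℕ) : rowsFrom P' k ⊆ rowsFrom P k :=
  Set.union_subset_union_left _ h

lemma rowsUpTo_mono {M M' : Coords m n} (h : M ⊆ M') (k : ℕ) : rowsUpTo M k ⊆ rowsUpTo M' k :=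
  Set.union_subset_union_left _ h

/-- The sectors obtained by changing the sign of the rows one after another. -/
abbrev rowSector (P M : Coords m n) (k : ℕ) : ModuleCat.{0} (DetR 𝕜 m n) :=
  sector 𝕜 (rowsFrom P k) (rowsUpTo M k)

/-- The short complexes connecting consecutive row sectors. -/
abbrev rowSequence (P M : Coords m n) (i : Fin m) : ShortComplex (ModuleCat.{0} (DetR 𝕜 m n)) :=
  sectorSequence 𝕜 (Sum.inl i) (rowsFrom_eq_insert P i) (rowsUpTo_eq_insert M i)

/-- The cohomology of row sectors with supports in the ideal of the first columns. -/
abbrev rowT (P M : Coords m n) (k j : ℕ) : Type :=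
  T (detJ 𝕜 m n) (rowSector 𝕜 P M k) j

/-- The connecting homomorphism between consecutive row sectors. -/
def rowδ (P M : Coords m n) (i : Fin m) (j : ℕ) :
    rowT 𝕜 P M (i + 1) j →ₗ[DetR 𝕜 m n] rowT 𝕜 P M i (j + 1) :=
  Tδ (detJ 𝕜 m n) (sectorSequence_shortExact (𝕜 := 𝕜) (Sum.inl i) (rowsFrom_eq_insert P i)
    (rowsUpTo_eq_insert M i)) j

/-- The iterated connecting homomorphism. -/
def rowΔ (P M : Coords m n) : ∀ (k : ℕ) (_ : k ≤ m) (j l : ℕ) (_ : j + k = l),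
    rowT 𝕜 P M k j →ₗ[DetR 𝕜 m n] rowT 𝕜 P M 0 l
  | 0, _, _, _, h => h ▸ LinearMap.id
  | k + 1, hk, j, l, h =>
    (rowΔ P M k (Nat.le_of_succ_le hk) (j + 1) l (by omega)).comp (rowδ 𝕜 P M ⟨k, hk⟩ j)

/-- The natural maps between row sectors. -/
abbrev rowMap {P P' M M' : Coords m n} (hP : P' ⊆ P) (hM : M ⊆ M') (k : ℕ) :
    rowSector 𝕜 P M k ⟶ rowSector 𝕜 P' M' k :=
  sectorMap (rowsFrom_mono hP k) (rowsUpTo_mono hM k)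

lemma rowδ_naturality {P P' M M' : Coords m n} (hP : P' ⊆ P) (hM : M ⊆ M') (i : Fin m) (j : ℕ)
    (x : rowT 𝕜 P M (i + 1) j) :
    rowδ 𝕜 P' M' i j (Tmap _ (rowMap 𝕜 hP hM (i + 1)) j x) =
      Tmap _ (rowMap 𝕜 hP hM i) (j + 1) (rowδ 𝕜 P M i j x) := by
  let f : rowSequence 𝕜 P M i ⟶ rowSequence 𝕜 P' M' i :=
    { τ₁ := rowMap 𝕜 hP hM i
      τ₂ := sectorMap (rowsFrom_mono hP _) (rowsUpTo_mono hM _)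
      τ₃ := rowMap 𝕜 hP hM (i + 1)
      comm₁₂ := by
        ext x
        obtain ⟨f, hf, rfl⟩ := exists_toSector_eq (𝕜 := 𝕜) x
        rfl
      comm₂₃ := by
        ext x
        obtain ⟨f, hf, rfl⟩ := exists_toSector_eq (𝕜 := 𝕜) x
        rfl }
  exact Tδ_naturality (detJ 𝕜 m n) _ _ f j x

lemma rowΔ_naturality {P P' M M' : Coords m n} (hP : P' ⊆ P) (hM : M ⊆ M') (k : ℕ) (hk : k ≤ m)
    (j l : ℕ) (h : j + k = l) (x : rowT 𝕜 P M k j) :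
    rowΔ 𝕜 P' M' k hk j l h (Tmap _ (rowMap 𝕜 hP hM k) j x) =
      Tmap _ (rowMap 𝕜 hP hM 0) l (rowΔ 𝕜 P M k hk j l h x) := by
  induction k generalizing j with
  | zero => subst h; rfl
  | succ k ih =>
    exact (congrArg _ (rowδ_naturality 𝕜 hP hM ⟨k, hk⟩ j x)).trans (ih _ _ _ _)

/-- A sector between consecutive row sectors has no cohomology if some column is free. -/
lemma subsingleton_T_sector {P M : Coords m n} (i : Fin m) (b : Fin n) (hb : (b : ℕ) < n - 1)
    (hiP : Sum.inl i ∉ P) (hiM : Sum.inl i ∉ M) (hbP : Sum.inr b ∉ P) (hbM : Sum.inr b ∉ M)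
    (j : ℕ) : Subsingleton (T (detJ 𝕜 m n) (sector 𝕜 P M) j) :=
  subsingleton_of_bijective (detJ 𝕜 m n) (sector 𝕜 P M) (detx 𝕜 m n i b)
    (Ideal.subset_span ⟨i, b, hb, rfl⟩)
    (bijective_detx i b hiP hiM hbP hbM) j

lemma rowδ_bijective {P M : Coords m n} (hPr : ∀ i, Sum.inl i ∉ P) (hMr : ∀ i, Sum.inl i ∉ M)
    {b : Fin n} (hb : (b : ℕ) < n - 1) (hbP : Sum.inr b ∉ P) (hbM : Sum.inr b ∉ M)
    (i : Fin m) (j : ℕ) : Function.Bijective (rowδ 𝕜 P M i j) := by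
  have h : ∀ j, Subsingleton (T (detJ 𝕜 m n)
      (sector 𝕜 (rowsFrom P (i + 1)) (rowsUpTo M i)) j) := by
    refine subsingleton_T_sector 𝕜 i b hb ?_ ?_ ?_ ?_
    · rintro (h | ⟨l, hl, hl'⟩)
      · exact hPr i h
      · obtain rfl := Sum.inl_injective hl
        omega
    · rintro (h | ⟨l, hl, hl'⟩)
      · exact hMr i h
      · obtain rfl := Sum.inl_injective hl
        omega
    · rintro (h | ⟨l, hl, -⟩)
      · exact hbP h
      · cases hl
    · rintro (h | ⟨l, hl, -⟩)
      · exact hbM h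
      · cases hl
  exact Tδ_bijective (detJ 𝕜 m n) _ j (h j) (h (j + 1))

lemma rowΔ_bijective {P M : Coords m n} (hPr : ∀ i, Sum.inl i ∉ P) (hMr : ∀ i, Sum.inl i ∉ M)
    {b : Fin n} (hb : (b : ℕ) < n - 1) (hbP : Sum.inr b ∉ P) (hbM : Sum.inr b ∉ M)
    (k : ℕ) (hk : k ≤ m) (j l : ℕ) (h : j + k = l) :
    Function.Bijective (rowΔ 𝕜 P M k hk j l h) := by
  induction k generalizing j with
  | zero => subst h; exact Function.bijective_id
  | succ k ih =>
    rw [rowΔ, LinearMap.coe_comp]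
    exact (ih _ _ _).comp (rowδ_bijective 𝕜 hPr hMr hb hbP hbM ⟨k, hk⟩ j)

lemma subsingleton_rowT {P M : Coords m n} (hPr : ∀ i, Sum.inl i ∉ P) (hMr : ∀ i, Sum.inl i ∉ M)
    {b : Fin n} (hb : (b : ℕ) < n - 1) (hbP : Sum.inr b ∉ P) (hbM : Sum.inr b ∉ M)
    (hm : 0 < m) (hn : 1 < n) (l : ℕ) (hl : m < l) :
    Subsingleton (rowT 𝕜 P M 0 l) := by
  obtain ⟨j, rfl⟩ : ∃ j, l = (j + 1) + m := ⟨l - m - 1, by omega⟩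
  have h : Subsingleton (rowT 𝕜 P M m (j + 1)) :=
    subsingleton_of_isPowTorsion _ _ (isPowTorsion_sector hm hn
      (Or.inl fun i => Or.inr ⟨i, rfl, i.2⟩)) j
  exact (rowΔ_bijective 𝕜 hPr hMr hb hbP hbM m le_rfl (j + 1) _ rfl).surjective.subsingleton

end Segre

namespace Segre
open TorsionExt

/-- The columns from the `k`-th on. -/
def colsFrom (k : ℕ) : Coords m n := {c | ∃ j : Fin n, c = Sum.inr j ∧ k ≤ j}

/-- The columns before the `k`-th. -/
def colsUpTo (k : ℕ) : Coords m n := {c | ∃ j : Fin n, c = Sum.inr j ∧ ↑j < k}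

variable {m n}

lemma colsFrom_eq_insert (b : Fin n) :
    colsFrom m n b = insert (Sum.inr b) (colsFrom m n (b + 1)) := by
  ext c
  simp only [colsFrom, Set.mem_ofPred_eq, Set.mem_insert_iff]
  constructor
  · rintro ⟨l, rfl, hl⟩
    rcases eq_or_lt_of_le hl with h | h
    · exact Or.inl (congrArg _ (Fin.ext h.symm))
    · exact Or.inr ⟨l, rfl, h⟩
  · rintro (rfl | ⟨l, rfl, hl⟩)
    · exact ⟨b, rfl, le_rfl⟩
    · exact ⟨l, rfl, by omega⟩

lemma colsUpTo_eq_insert (b : Fin n) :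
    colsUpTo m n (b + 1) = insert (Sum.inr b) (colsUpTo m n b) := by
  ext c
  simp only [colsUpTo, Set.mem_ofPred_eq, Set.mem_insert_iff]
  constructor
  · rintro ⟨l, rfl, hl⟩
    rcases eq_or_lt_of_le (Nat.lt_succ_iff.1 hl) with h | h
    · exact Or.inl (congrArg _ (Fin.ext h))
    · exact Or.inr ⟨l, rfl, h⟩
  · rintro (rfl | ⟨l, rfl, hl⟩)
    · exact ⟨b, rfl, Nat.lt_succ_self _⟩
    · exact ⟨l, rfl, by omega⟩

lemma inl_notMem_colsFrom (k : ℕ) (i : Fin m) : Sum.inl i ∉ colsFrom m n k := by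
  rintro ⟨j, h, -⟩
  cases h

lemma inl_notMem_colsUpTo (k : ℕ) (i : Fin m) : Sum.inl i ∉ colsUpTo m n k := by
  rintro ⟨j, h, -⟩
  cases h

lemma inr_mem_colsFrom {k : ℕ} {b : Fin n} : Sum.inr b ∈ colsFrom m n k ↔ k ≤ b :=
  ⟨fun ⟨_, h, hj⟩ => Sum.inr_injective h ▸ hj, fun h => ⟨b, rfl, h⟩⟩

lemma inr_mem_colsUpTo {k : ℕ} {b : Fin n} : Sum.inr b ∈ colsUpTo m n k ↔ ↑b < k :=
  ⟨fun ⟨_, h, hj⟩ => Sum.inr_injective h ▸ hj, fun h => ⟨b, rfl, h⟩⟩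

lemma rowsFrom_colsFrom_eq_insert (b : Fin n) (k : ℕ) :
    rowsFrom (colsFrom m n b) k = insert (Sum.inr b) (rowsFrom (colsFrom m n (b + 1)) k) := by
  rw [colsFrom_eq_insert, rowsFrom, Set.insert_union, rowsFrom]

lemma rowsUpTo_colsUpTo_eq_insert (b : Fin n) (k : ℕ) :
    rowsUpTo (colsUpTo m n (b + 1)) k = insert (Sum.inr b) (rowsUpTo (colsUpTo m n b) k) := by
  rw [colsUpTo_eq_insert, rowsUpTo, Set.insert_union, rowsUpTo]

variable (m) in
/-- The short complexes obtained by changing the sign of the `b`-th column. -/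
abbrev colSequence (b : Fin n) : ShortComplex (ModuleCat.{0} (DetR 𝕜 m n)) :=
  sectorSequence 𝕜 (Sum.inr b) (rowsFrom_colsFrom_eq_insert b 0) (rowsUpTo_colsUpTo_eq_insert b 0)

variable (m) in
lemma colSequence_shortExact (b : Fin n) : (colSequence 𝕜 m b).ShortExact :=
  sectorSequence_shortExact (𝕜 := 𝕜) (Sum.inr b) (rowsFrom_colsFrom_eq_insert b 0)
    (rowsUpTo_colsUpTo_eq_insert b 0)

variable (m n) in
/-- The cohomology of the sectors between `R` and the sectors with negative columns. -/
abbrev colT (k j : ℕ) : Type := rowT 𝕜 (colsFrom m n k) (colsUpTo m n k) 0 j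

variable (m) in
/-- The connecting homomorphism of a column sequence. -/
def colδ (b : Fin n) (j : ℕ) : colT 𝕜 m n (b + 1) j →ₗ[DetR 𝕜 m n] colT 𝕜 m n b (j + 1) :=
  Tδ (detJ 𝕜 m n) (colSequence_shortExact 𝕜 m b) j

lemma rowΔ_col_bijective (b : Fin n) (hb : (b : ℕ) < n - 1) (k : ℕ) (hk : k ≤ m) (j l : ℕ)
    (h : j + k = l) :
    Function.Bijective (rowΔ 𝕜 (colsFrom m n (b + 1)) (colsUpTo m n b) k hk j l h) :=
  rowΔ_bijective 𝕜 (inl_notMem_colsFrom _) (inl_notMem_colsUpTo _) hb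
    (fun h => absurd (inr_mem_colsFrom.1 h) (by omega))
    (fun h => absurd (inr_mem_colsUpTo.1 h) (by omega)) k hk j l h

lemma exists_injective_colT (hm : 0 < m) (hn : 1 < n) (k : ℕ) (hk : k ≤ n - 1) (j l : ℕ)
    (hj : m < j) (h : j + k = l) :
    ∃ F : colT 𝕜 m n k j →ₗ[DetR 𝕜 m n] colT 𝕜 m n 0 l, Function.Injective F := by
  induction k generalizing j with
  | zero => subst h; exact ⟨LinearMap.id, Function.injective_id⟩
  | succ k ih =>
    obtain ⟨F, hF⟩ := ih (by omega) (j + 1) (by omega) (by omega)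
    let b : Fin n := ⟨k, by omega⟩
    have hs : Subsingleton (rowT 𝕜 (colsFrom m n (b + 1)) (colsUpTo m n b) 0 j) :=
      subsingleton_rowT 𝕜 (inl_notMem_colsFrom _) (inl_notMem_colsUpTo _) (b := b) hk
        (fun h => absurd (inr_mem_colsFrom.1 h) (by omega))
        (fun h => absurd (inr_mem_colsUpTo.1 h) (by omega)) hm hn j hj
    refine ⟨F.comp (colδ 𝕜 m b j), ?_⟩
    rw [LinearMap.coe_comp]
    exact hF.comp (Tδ_injective (detJ 𝕜 m n) (colSequence_shortExact 𝕜 m b) j hs)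

variable (m n) in
/-- The torsion sector whose socle is used. -/
abbrev socleSector (k : ℕ) : ModuleCat.{0} (DetR 𝕜 m n) :=
  rowSector 𝕜 (colsFrom m n (k + 1)) (colsUpTo m n k) m

lemma exists_socleSector_map (hm : 2 ≤ m) (b : Fin n) (hb : (b : ℕ) + 2 = n) :
    ∃ A : socleSector 𝕜 m n b →ₗ[DetR 𝕜 m n] colT 𝕜 m n b m, Function.Injective A ∧
      ∀ y, Tmap (detJ 𝕜 m n) (colSequence 𝕜 m b).f m (A (ev _ _ y)) =
        rowΔ 𝕜 (colsFrom m n (b + 1)) (colsUpTo m n b) m le_rfl 0 m (zero_add m) y := by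
  have hev := ev_bijective (detJ 𝕜 m n) (socleSector 𝕜 m n b) (isPowTorsion_sector (by omega)
    (by omega) (Or.inl fun i => Or.inr ⟨i, rfl, i.2⟩))
  have htor : ∀ j, Subsingleton (colT 𝕜 m n (b + 1) (j + 1)) :=
    subsingleton_of_isPowTorsion (detJ 𝕜 m n) _ (isPowTorsion_sector (by omega) (by omega)
      (Or.inr fun j hj => Or.inl (inr_mem_colsUpTo.2 (by omega))))
  have hf : Function.Bijective (Tmap (detJ 𝕜 m n) (colSequence 𝕜 m b).f m) := by
    obtain ⟨m, rfl⟩ : ∃ p, m = p + 2 := ⟨m - 2, by omega⟩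
    exact Tmap_f_bijective (detJ 𝕜 (m + 2) n) (colSequence_shortExact 𝕜 (m + 2) b) (m + 1)
      (htor m) (htor (m + 1))
  let E := LinearEquiv.ofBijective _ hev
  let F := LinearEquiv.ofBijective _ hf
  let G := rowΔ 𝕜 (colsFrom m n (b + 1)) (colsUpTo m n b) m le_rfl 0 m (zero_add m)
  have hG : Function.Injective G := (rowΔ_col_bijective 𝕜 b (by omega) m le_rfl 0 m _).1
  refine ⟨F.symm.toLinearMap.comp (G.comp E.symm.toLinearMap), ?_, ?_⟩
  · exact F.symm.injective.comp (hG.comp E.symm.injective)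
  · intro y
    have h1 : E.symm (ev _ _ y) = y := E.symm_apply_apply y
    exact (congrArg (fun t => F (F.symm (G t))) h1).trans (F.apply_symm_apply (G y))

/-- The cohomology of `R` receives a map from a torsion sector, whose kernel is controlled. -/
lemma exists_socleSector_map_colT (hm : 2 ≤ m) (b : Fin n) (hb : (b : ℕ) + 2 = n) :
    ∃ A : socleSector 𝕜 m n b →ₗ[DetR 𝕜 m n] colT 𝕜 m n 0 (m + b),
      ∀ z, A z = 0 → ∃ f hf, z = toSector _ f hf ∧
        ∀ g : Exponent m n, f.coeff g ≠ 0 → 0 ≤ g (Sum.inr b) := by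
  obtain ⟨A, hA, hA'⟩ := exists_socleSector_map 𝕜 hm b hb
  obtain ⟨k, hk⟩ := b
  cases k with
  | zero =>
    refine ⟨A, fun z hz => ⟨0, Submodule.zero_mem _, ?_, fun g hg => absurd rfl hg⟩⟩
    rw [← map_zero A] at hz
    exact hA hz
  | succ k =>
    obtain ⟨F, hF⟩ := exists_injective_colT 𝕜 (m := m) (n := n) (by omega) (by omega) k
      (by omega) (m + 1) (m + (k + 1)) (by omega) (by omega)
    let b' : Fin n := ⟨k, by omega⟩
    refine ⟨F.comp ((colδ 𝕜 m b' m).comp A), fun z hz => ?_⟩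
    replace hz : colδ 𝕜 m b' m (A z) = 0 := hF (hz.trans (map_zero F).symm)
    obtain ⟨y, hy⟩ := exact_right (detJ 𝕜 m n) (colSequence_shortExact 𝕜 m b') m _ hz
    obtain ⟨y, rfl⟩ := (rowΔ_col_bijective 𝕜 b' (by simp only [b'] at hb ⊢; omega) m le_rfl
      0 m (zero_add m)).2 y
    obtain ⟨w, rfl⟩ := (ev_bijective (detJ 𝕜 m n) (socleSector 𝕜 m n (k + 1))
      (isPowTorsion_sector (by omega) (by omega) (Or.inl fun i => Or.inr ⟨i, rfl, i.2⟩))).2 z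
    have hP : colsFrom m n (k + 2) ⊆ colsFrom m n (k + 1) := by
      rintro _ ⟨j, rfl, hj⟩
      exact ⟨j, rfl, by omega⟩
    have hM : colsUpTo m n k ⊆ colsUpTo m n (k + 1) := by
      rintro _ ⟨j, rfl, hj⟩
      exact ⟨j, rfl, by omega⟩
    have hcomp : (colSequence 𝕜 m b').g ≫ (colSequence 𝕜 m ⟨k + 1, hk⟩).f = rowMap 𝕜 hP hM 0 := by
      ext x
      obtain ⟨f, hf, rfl⟩ := exists_toSector_eq (𝕜 := 𝕜) x
      rfl
    have h1 : Tmap (detJ 𝕜 m n) (rowMap 𝕜 hP hM m) 0 y = w := by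
      refine (rowΔ_col_bijective 𝕜 ⟨k + 1, hk⟩ ?_ m le_rfl 0 m (zero_add m)).1 ?_
      · exact Nat.lt_sub_of_add_lt (by omega)
      · refine (rowΔ_naturality 𝕜 hP hM m le_rfl 0 m (zero_add m) y).trans ?_
        rw [← hcomp]
        refine (Tmap_comp (detJ 𝕜 m n) _ _ m _).symm.trans ?_
        exact (congrArg _ hy).trans (hA' w)
    obtain ⟨f, hf, hfy⟩ := exists_toSector_eq (𝕜 := 𝕜) (ev (detJ 𝕜 m n) _ y)
    refine ⟨f, regionModule_anti (rowsFrom_mono hP m) hf, ?_, fun g hg => (hf g hg).2 _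
      (Or.inl (inr_mem_colsFrom.2 le_rfl))⟩
    rw [← h1, ev_Tmap, ← hfy]
    rfl

end Segre

/-- If the socle of a module over a Noetherian local ring is finitely generated, then any sequence
of socle elements in its source is eventually dependent modulo the kernel of a linear map. -/
lemma exists_mem_span_of_finite_socle {R Z H : Type} [CommRing R] [IsLocalRing R]
    [IsNoetherianRing R] [AddCommGroup Z] [Module R Z] [AddCommGroup H] [Module R H]
    (hfin : Module.Finite R (IsLocalRing.ResidueField R →ₗ[R] H)) (Θ : Z →ₗ[R] H) (q : ℕ → Z)
    (hq : ∀ N, ∀ r ∈ IsLocalRing.maximalIdeal R, r • q N = 0) :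
    ∃ N, ∃ s ∈ Submodule.span R (q '' {k | k < N}), Θ (q N - s) = 0 := by
  let ℓ : ℕ → IsLocalRing.ResidueField R →ₗ[R] H := fun N =>
    Submodule.liftQ (IsLocalRing.maximalIdeal R) (LinearMap.toSpanSingleton R H (Θ (q N)))
      fun r hr => by
        rw [LinearMap.mem_ker, LinearMap.toSpanSingleton_apply, ← map_smul, hq N r hr, map_zero]
  have hℓ : ∀ N, ℓ N 1 = Θ (q N) := fun N => one_smul R _
  let ev₁ : (IsLocalRing.ResidueField R →ₗ[R] H) →ₗ[R] H := LinearMap.applyₗ 1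
  have hN : IsNoetherian R (IsLocalRing.ResidueField R →ₗ[R] H) := inferInstance
  obtain ⟨N, h⟩ := monotone_stabilizes_iff_noetherian.2 hN
    ⟨fun N => Submodule.span R (ℓ '' {k | k < N}), fun a b hab =>
      Submodule.span_mono (Set.image_mono fun k hk => lt_of_lt_of_le hk hab)⟩
  have h1 : ℓ N ∈ Submodule.span R (ℓ '' {k | k < N}) := by
    have h2 : ℓ N ∈ Submodule.span R (ℓ '' {k | k < N + 1}) :=
      Submodule.subset_span ⟨N, Nat.lt_succ_self N, rfl⟩
    exact (h (N + 1) (Nat.le_succ N)).ge h2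
  have h3 : Θ (q N) ∈ (Submodule.span R (q '' {k | k < N})).map Θ := by
    have h4 := Submodule.mem_map_of_mem (f := ev₁) h1
    rw [Submodule.map_span, Set.image_image] at h4 ⊢
    simpa only [ev₁, LinearMap.applyₗ_apply_apply, hℓ] using h4
  obtain ⟨s, hs, hs'⟩ := h3
  exact ⟨N, s, hs, by rw [map_sub, hs', sub_self]⟩

namespace Segre
open TorsionExt
variable {m}

variable (m) in
/-- The exponents of the monomials representing socle elements. -/
def socleExponent (e N : ℕ) : Exponent m (e + 2) :=
  Sum.elim (fun _ => -1) fun j =>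
    if (j : ℕ) < e then -1 else if (j : ℕ) = e then -(m + N : ℤ) else (N + e : ℤ)

lemma socleExponent_inr (e N : ℕ) (h : e < e + 2) :
    socleExponent m e N (Sum.inr ⟨e, h⟩) = -(m + N : ℤ) := by
  simp [socleExponent]

lemma socleExponent_mem_region (e N : ℕ) :
    socleExponent m e N ∈ region (rowsFrom (colsFrom m (e + 2) (e + 1)) m) := by
  constructor
  · simp only [Balanced, socleExponent, Sum.elim_inl, Sum.elim_inr]
    rw [Fin.sum_univ_castSucc, Fin.sum_univ_castSucc]
    simp
    ring
  · rintro c (⟨j, rfl, hj⟩ | ⟨i, -, hi⟩)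
    · have h1 : ¬ (j : ℕ) < e := by omega
      have h2 : ¬ (j : ℕ) = e := by omega
      simp only [socleExponent, Sum.elim_inr, h1, h2, if_false]
      positivity
    · exact absurd i.2 (by omega)

lemma socleExponent_notMem_cut (e N : ℕ) :
    socleExponent m e N ∉ cut (rowsUpTo (colsUpTo m (e + 2) e) m) := by
  rintro ⟨c, ⟨j, rfl, hj⟩ | ⟨i, rfl, hi⟩, hc⟩
  · simp [socleExponent, hj] at hc
  · simp [socleExponent] at hc

lemma single_socleExponent_mem (e N : ℕ) :
    (HahnSeries.single (socleExponent m e N) 1 : Laurent 𝕜 m (e + 2)) ∈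
      regionModule 𝕜 (rowsFrom (colsFrom m (e + 2) (e + 1)) m) := fun g hg => by
  obtain rfl : g = socleExponent m e N := by
    by_contra h
    exact hg (HahnSeries.coeff_single_of_ne h)
  exact socleExponent_mem_region e N

variable (m) in
/-- The socle elements of the torsion sector. -/
def socleElement (e N : ℕ) : socleSector 𝕜 m (e + 2) e :=
  toSector _ (HahnSeries.single (socleExponent m e N) 1) (single_socleExponent_mem 𝕜 e N)

lemma exists_inl_pos {n : ℕ} {g : Exponent m n} (hg : Balanced g) (h0 : ∀ c, 0 ≤ g c)
    (h : g ≠ 0) : ∃ i, 0 < g (Sum.inl i) := by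
  by_contra! hi
  have h1 : ∀ i, g (Sum.inl i) = 0 := fun i => le_antisymm (hi i) (h0 _)
  have h2 : ∑ j, g (Sum.inr j) = 0 := by
    rw [← hg]
    exact Finset.sum_eq_zero fun i _ => h1 i
  rw [Finset.sum_eq_zero_iff_of_nonneg fun j _ => h0 _] at h2
  refine h (funext ?_)
  rintro (i | j)
  · exact h1 i
  · exact h2 j (Finset.mem_univ j)

lemma smul_socleElement (e N : ℕ) [IsLocalRing (DetR 𝕜 m (e + 2))] {r : DetR 𝕜 m (e + 2)}
    (hr : r ∈ IsLocalRing.maximalIdeal (DetR 𝕜 m (e + 2))) : r • socleElement 𝕜 m e N = 0 := by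
  refine toSector_eq_zero_iff.2 fun g hg => ?_
  obtain ⟨a, b, ha, hb, rfl⟩ := exists_coeff_ne_zero_of_mul hg
  obtain rfl : b = socleExponent m e N := by
    by_contra h
    exact hb (HahnSeries.coeff_single_of_ne h)
  obtain ⟨i, hi⟩ := exists_inl_pos (balanced_of_coeff_phi_ne_zero ha)
    (nonneg_of_coeff_phi_ne_zero ha) (by rintro rfl; exact ha (coeff_phi_zero hr))
  refine ⟨Sum.inl i, Or.inr ⟨i, rfl, i.2⟩, ?_⟩
  simp only [Pi.add_apply, socleExponent, Sum.elim_inl]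
  omega

lemma exists_rep_of_mem_span (e N : ℕ) (s : socleSector 𝕜 m (e + 2) e)
    (hs : s ∈ Submodule.span (DetR 𝕜 m (e + 2)) (socleElement 𝕜 m e '' {k | k < N})) :
    ∃ f hf, s = toSector _ f hf ∧ ∀ g : Exponent m (e + 2), f.coeff g ≠ 0 →
      -(m + N : ℤ) < g (Sum.inr ⟨e, by omega⟩) := by
  induction hs using Submodule.span_induction with
  | mem s hs =>
    obtain ⟨k, hk, rfl⟩ := hs
    refine ⟨_, _, rfl, fun g hg => ?_⟩
    obtain rfl : g = socleExponent m e k := by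
      by_contra h
      exact hg (HahnSeries.coeff_single_of_ne h)
    rw [socleExponent_inr]
    have : k < N := hk
    omega
  | zero => exact ⟨0, Submodule.zero_mem _, rfl, fun g hg => absurd rfl hg⟩
  | add s t _ _ hs ht =>
    obtain ⟨f, hf, rfl, hf'⟩ := hs
    obtain ⟨f₁, hf₁, rfl, hf₁'⟩ := ht
    refine ⟨f + f₁, Submodule.add_mem _ hf hf₁, rfl, fun g hg => ?_⟩
    by_cases h : f.coeff g = 0
    · refine hf₁' g fun h' => hg ?_
      rw [HahnSeries.coeff_add, h, h', add_zero]
    · exact hf' g h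
  | smul r s _ hs =>
    obtain ⟨f, hf, rfl, hf'⟩ := hs
    refine ⟨r • f, Submodule.smul_mem _ r hf, rfl, fun g hg => ?_⟩
    obtain ⟨a, b, ha, hb, rfl⟩ := exists_coeff_ne_zero_of_mul hg
    have h1 : 0 ≤ a (Sum.inr ⟨e, by omega⟩) := nonneg_of_coeff_phi_ne_zero ha _
    have h2 := hf' b hb
    rw [Pi.add_apply]
    omega

lemma exists_socleSector_map_localCohomology (hm : 2 ≤ m) (e : ℕ)
    [IsLocalRing (DetR 𝕜 m (e + 2))] :
    ∃ Θ : socleSector 𝕜 m (e + 2) e →ₗ[DetR 𝕜 m (e + 2)]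
        (localCohomology (detJ 𝕜 m (e + 2)) (m + e)).obj
          (ModuleCat.of (DetR 𝕜 m (e + 2)) (DetR 𝕜 m (e + 2))),
      ∀ z, Θ z = 0 → ∃ f hf, z = toSector _ f hf ∧
        ∀ g : Exponent m (e + 2), f.coeff g ≠ 0 → 0 ≤ g (Sum.inr ⟨e, by omega⟩) := by
  obtain ⟨A, hA⟩ := exists_socleSector_map_colT 𝕜 hm (⟨e, by omega⟩ : Fin (e + 2)) rfl
  obtain ⟨φ⟩ := exists_iso_sector (𝕜 := 𝕜) (m := m) (n := e + 2)
    (P := rowsFrom (colsFrom m (e + 2) 0) 0) (M := rowsUpTo (colsUpTo m (e + 2) 0) 0)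
    (by
      rintro (i | j)
      · exact Or.inr ⟨i, rfl, Nat.zero_le _⟩
      · exact Or.inl ⟨j, rfl, Nat.zero_le _⟩)
    (by
      rintro _ (⟨j, -, hj⟩ | ⟨i, -, hi⟩)
      · exact Nat.not_lt_zero _ hj
      · exact Nat.not_lt_zero _ hi)
  have hφ : ∀ j, Function.Injective (Tmap (detJ 𝕜 m (e + 2)) φ.hom j) := fun j => by
    refine Function.LeftInverse.injective (g := Tmap (detJ 𝕜 m (e + 2)) φ.inv j) fun x => ?_
    rw [Tmap_comp, φ.hom_inv_id, Tmap_id]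
  obtain ⟨d, hd⟩ : ∃ d, m + e = d + 1 := ⟨m + e - 1, by omega⟩
  replace hA : ∀ z, A z = 0 → ∃ f hf, z = toSector _ f hf ∧
    ∀ g : Exponent m (e + 2), f.coeff g ≠ 0 → 0 ≤ g (Sum.inr ⟨e, by omega⟩) := hA
  change socleSector 𝕜 m (e + 2) e →ₗ[DetR 𝕜 m (e + 2)] colT 𝕜 m (e + 2) 0 (m + e) at A
  generalize m + e = l at A hA hd ⊢
  subst hd
  refine ⟨(localCohomologyComparison (detJ 𝕜 m (e + 2)) d _).comp
    ((Tmap (detJ 𝕜 m (e + 2)) φ.hom (d + 1)).comp A), fun z hz => hA z ?_⟩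
  have h1 := localCohomologyComparison_injective _ _ _ (hz.trans (map_zero _).symm)
  exact hφ _ (h1.trans (map_zero _).symm)

end Segre

open Segre

/-- the socle `Hom_R(𝕜, H^{m+n-2}_I(R))` is an infinite-dimensional
`𝕜`-vector space.  Since this module is annihilated by `𝔪`, being infinite dimensional
over `𝕜 = R/𝔪` is equivalent to not being a finitely generated `R`-module. -/
theorem statement9 [IsLocalRing (DetR 𝕜 m n)] (hm : 2 ≤ m) (hn : 2 ≤ n) :
    ¬ Module.Finite (DetR 𝕜 m n)
      (IsLocalRing.ResidueField (DetR 𝕜 m n) →ₗ[DetR 𝕜 m n]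
        ((localCohomology (detJ 𝕜 m n) (m + n - 2)).obj
          (ModuleCat.of (DetR 𝕜 m n) (DetR 𝕜 m n)))) := by
  intro hfin
  obtain ⟨e, rfl⟩ : ∃ e, n = e + 2 := ⟨n - 2, by omega⟩
  obtain ⟨Θ, hΘ⟩ := exists_socleSector_map_localCohomology 𝕜 hm e
  obtain ⟨N, s, hs, hN⟩ := exists_mem_span_of_finite_socle hfin Θ (socleElement 𝕜 m e)
    fun N r hr => smul_socleElement 𝕜 e N hr
  obtain ⟨f, hf, h, hf'⟩ := hΘ _ hN
  obtain ⟨f₁, hf₁, rfl, hf₁'⟩ := exists_rep_of_mem_span 𝕜 e N s hs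
  have h1 : HahnSeries.single (socleExponent m e N) 1 - f₁ - f ∈
      cutModule 𝕜 (rowsUpTo (colsUpTo m (e + 2) e) m) :=
    (toSector_eq_zero_iff (hf := Submodule.sub_mem _ (Submodule.sub_mem _
      (single_socleExponent_mem 𝕜 e N) hf₁) hf)).1 (sub_eq_zero.2 h)
  refine socleExponent_notMem_cut e N (h1 _ ?_)
  have h2 : f₁.coeff (socleExponent m e N) = 0 := by
    by_contra h'
    have := hf₁' _ h'
    rw [socleExponent_inr] at this
    omega
  have h3 : f.coeff (socleExponent m e N) = 0 := by
    by_contra h'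
    have := hf' _ h'
    rw [socleExponent_inr] at this
    omega
  rw [HahnSeries.coeff_sub, HahnSeries.coeff_sub, h2, h3, HahnSeries.coeff_single_same]
  simp
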